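/- Let s ≥ 1 and let f : [-π,π] → ℂ^{s×s} be a matrix-valued function with each entry f_{j,k} ∈ L¹([-π,π]), whose Fourier coefficients A_k = (1/2π)∫_{-π}^{π} f(θ)e^{-ikθ}dθ are all s×s Hermitian matrices. Let T_{n,s}[f] ∈ ℂ^{sn×sn} be the block Toeplitz matrix whose (j,k) block (j,k ∈ {1,…,n}) is A_{j-k}, let Y_n be the n×n anti-identity matrix, and I_s the s×s identity. Then (Y_n ⊗ I_s)T_{n,s}[f] is Hermitian and the sequence {(Y_n ⊗ I_s)T_{n,s}[f]}_n has asymptotic eigenvalue distribution described by ψ_{|f|}, where |f| = (ff*)^{1/2}; i.e. for every continuous compactly supported F: ℂ → ℂ, lim_{n→∞} (1/(sn))∑_{j=1}^{sn} F(λ_j((Y_n ⊗ I_s)T_{n,s}[f])) = (1/4π)∫_{-π}^{π} (1/s)∑_{j=1}^{s}[F(λ_j(|f|(θ))) + F(−λ_j(|f|(θ)))]dθ. -/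

import Mathlib

open MeasureTheory Filter Matrix

/-- The eigenvalues of `|f|(θ) = (f(θ)f(θ)ᴴ)^{1/2}`, i.e. the singular values of the
matrix `f(θ)`, defined as the nonnegative square roots of the eigenvalues of
`f(θ) * f(θ)ᴴ`. -/
noncomputable def absEigenvalues {s : ℕ} (G : Matrix (Fin s) (Fin s) ℂ) : Fin s → ℝ :=
  fun j => Real.sqrt ((Matrix.isHermitian_mul_conjTranspose_self G).eigenvalues j)

namespace Matrix.IsHermitian

variable {m : Type*} [Fintype m] [DecidableEq m] {H : Matrix m m ℂ}

/-- The matrix `φ(H)` obtained from a Hermitian matrix `H` by applying `φ` to its eigenvalues. -/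
noncomputable def funCalc (hH : H.IsHermitian) (φ : ℝ → ℂ) : Matrix m m ℂ :=
  (hH.eigenvectorUnitary : Matrix m m ℂ) * diagonal (φ ∘ hH.eigenvalues) *
    star (hH.eigenvectorUnitary : Matrix m m ℂ)

lemma funCalc_add (hH : H.IsHermitian) (φ ψ : ℝ → ℂ) :
    hH.funCalc (φ + ψ) = hH.funCalc φ + hH.funCalc ψ := by
  have : diagonal ((φ + ψ) ∘ hH.eigenvalues) =
      diagonal (φ ∘ hH.eigenvalues) + diagonal (ψ ∘ hH.eigenvalues) := by
    rw [diagonal_add]; rfl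
  rw [funCalc, this, mul_add, add_mul]; rfl

lemma funCalc_mul (hH : H.IsHermitian) (φ ψ : ℝ → ℂ) :
    hH.funCalc (φ * ψ) = hH.funCalc φ * hH.funCalc ψ := by
  have h1 : diagonal ((φ * ψ) ∘ hH.eigenvalues) =
      diagonal (φ ∘ hH.eigenvalues) * diagonal (ψ ∘ hH.eigenvalues) := by
    rw [diagonal_mul_diagonal]; rfl
  have h2 : star (hH.eigenvectorUnitary : Matrix m m ℂ) * hH.eigenvectorUnitary = 1 :=
    Unitary.coe_star_mul_self _
  simp only [funCalc, h1, mul_assoc]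
  rw [← mul_assoc (star _) (hH.eigenvectorUnitary : Matrix m m ℂ), h2, one_mul]

lemma funCalc_const (hH : H.IsHermitian) (c : ℂ) : hH.funCalc (fun _ => c) = c • 1 := by
  have h1 : diagonal ((fun _ => c) ∘ hH.eigenvalues) = c • (1 : Matrix m m ℂ) := by
    rw [smul_one_eq_diagonal]; rfl
  rw [funCalc, h1, mul_smul_comm, mul_one, smul_mul_assoc,
    Unitary.mul_star_self_of_mem hH.eigenvectorUnitary.2]

lemma funCalc_ofReal (hH : H.IsHermitian) : hH.funCalc (fun x => (x : ℂ)) = H :=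
  (hH.spectral_theorem).symm

lemma funCalc_star (hH : H.IsHermitian) (φ : ℝ → ℂ) :
    hH.funCalc (star φ) = (hH.funCalc φ)ᴴ := by
  simp only [funCalc, conjTranspose_mul, diagonal_conjTranspose, star_eq_conjTranspose,
    conjTranspose_conjTranspose, mul_assoc]
  rfl

lemma trace_funCalc (hH : H.IsHermitian) (φ : ℝ → ℂ) :
    (hH.funCalc φ).trace = ∑ j, φ (hH.eigenvalues j) := by
  rw [funCalc, trace_mul_comm, ← mul_assoc, Unitary.coe_star_mul_self, one_mul, trace_diagonal]
  rfl

lemma funCalc_pow (hH : H.IsHermitian) (k : ℕ) : hH.funCalc (fun x => (x : ℂ) ^ k) = H ^ k := by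
  induction k with
  | zero => simpa using hH.funCalc_const 1
  | succ k ih =>
    rw [pow_succ, ← ih, ← congrArg (_ * ·) hH.funCalc_ofReal, ← funCalc_mul]; rfl

lemma sum_eigenvalues_pow (hH : H.IsHermitian) (k : ℕ) :
    ∑ j, (hH.eigenvalues j : ℂ) ^ k = (H ^ k).trace := by
  rw [← hH.funCalc_pow, trace_funCalc]

open scoped Matrix.Norms.L2Operator

lemma norm_funCalc_le (hH : H.IsHermitian) {φ : ℝ → ℂ} {b : ℝ} (hb : 0 ≤ b)
    (hφ : ∀ x, ‖φ x‖ ≤ b) : ‖hH.funCalc φ‖ ≤ b := by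
  rw [funCalc, ← Unitary.coe_star, CStarRing.norm_mul_coe_unitary, CStarRing.norm_coe_unitary_mul,
    l2_opNorm_diagonal]
  exact (pi_norm_le_iff_of_nonneg hb).2 fun j => hφ _

end Matrix.IsHermitian

open scoped Matrix.Norms.L2Operator in
/-- A bounded continuous function whose functional calculus is Lipschitz in the trace norm, which
is expressed by duality with the operator norm. -/
structure TraceLipschitz (φ : ℝ → ℂ) : Prop where
  continuous : Continuous φ
  bounded : ∃ b, 0 ≤ b ∧ ∀ x, ‖φ x‖ ≤ b
  lipschitz : ∃ C, 0 ≤ C ∧ ∀ (m : Type) [Fintype m] [DecidableEq m] (H K : Matrix m m ℂ)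
    (hH : H.IsHermitian) (hK : K.IsHermitian) (τ : ℝ),
    (∀ M : Matrix m m ℂ, ‖(M * (H - K)).trace‖ ≤ τ * ‖M‖) →
    ∀ M : Matrix m m ℂ, ‖(M * (hH.funCalc φ - hK.funCalc φ)).trace‖ ≤ C * τ * ‖M‖

namespace TraceLipschitz

open scoped Matrix.Norms.L2Operator

variable {φ ψ : ℝ → ℂ}

lemma const (c : ℂ) : TraceLipschitz fun _ => c := by
  refine ⟨continuous_const, ⟨‖c‖, norm_nonneg _, fun _ => le_rfl⟩, 0, le_rfl, ?_⟩
  intro m _ _ H K hH hK τ _ M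
  simp [Matrix.IsHermitian.funCalc_const]

lemma add (hφ : TraceLipschitz φ) (hψ : TraceLipschitz ψ) : TraceLipschitz (φ + ψ) := by
  obtain ⟨a, ha, hφa⟩ := hφ.bounded
  obtain ⟨b, hb, hψb⟩ := hψ.bounded
  obtain ⟨C, hC, hφC⟩ := hφ.lipschitz
  obtain ⟨D, hD, hψD⟩ := hψ.lipschitz
  refine ⟨hφ.continuous.add hψ.continuous, ⟨a + b, by positivity, fun x =>
    (norm_add_le _ _).trans (add_le_add (hφa x) (hψb x))⟩, C + D, by positivity, ?_⟩
  intro m _ _ H K hH hK τ hτ M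
  have e : M * (hH.funCalc (φ + ψ) - hK.funCalc (φ + ψ)) =
      M * (hH.funCalc φ - hK.funCalc φ) + M * (hH.funCalc ψ - hK.funCalc ψ) := by
    rw [IsHermitian.funCalc_add, IsHermitian.funCalc_add]; noncomm_ring
  rw [e, trace_add]
  calc _ ≤ C * τ * ‖M‖ + D * τ * ‖M‖ := (norm_add_le _ _).trans
        (add_le_add (hφC m H K hH hK τ hτ M) (hψD m H K hH hK τ hτ M))
    _ = _ := by ring

lemma star (hφ : TraceLipschitz φ) : TraceLipschitz (star φ) := by
  obtain ⟨a, ha, hφa⟩ := hφ.bounded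
  obtain ⟨C, hC, hφC⟩ := hφ.lipschitz
  refine ⟨hφ.continuous.star, ⟨a, ha, fun x => by simpa using hφa x⟩, C, hC, ?_⟩
  intro m _ _ H K hH hK τ hτ M
  have e : (M * (hH.funCalc (Star.star φ) - hK.funCalc (Star.star φ))).trace =
      Star.star (Mᴴ * (hH.funCalc φ - hK.funCalc φ)).trace := by
    rw [IsHermitian.funCalc_star, IsHermitian.funCalc_star, ← conjTranspose_sub,
      ← trace_conjTranspose, conjTranspose_mul, conjTranspose_conjTranspose, trace_mul_comm]
  rw [e, norm_star, ← l2_opNorm_conjTranspose M]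
  exact hφC m H K hH hK τ hτ _

lemma tau_nonneg {m : Type} [Fintype m] [DecidableEq m] {D : Matrix m m ℂ} {τ : ℝ}
    (hτ : ∀ M : Matrix m m ℂ, ‖(M * D).trace‖ ≤ τ * ‖M‖) (M : Matrix m m ℂ) : 0 ≤ τ * ‖M‖ :=
  (norm_nonneg _).trans (hτ M)

lemma mul (hφ : TraceLipschitz φ) (hψ : TraceLipschitz ψ) : TraceLipschitz (φ * ψ) := by
  obtain ⟨a, ha, hφa⟩ := hφ.bounded
  obtain ⟨b, hb, hψb⟩ := hψ.bounded
  obtain ⟨C, hC, hφC⟩ := hφ.lipschitz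
  obtain ⟨D, hD, hψD⟩ := hψ.lipschitz
  refine ⟨hφ.continuous.mul hψ.continuous, ⟨a * b, by positivity, fun x =>
    (norm_mul_le _ _).trans (mul_le_mul (hφa x) (hψb x) (norm_nonneg _) ha)⟩,
    D * a + C * b, by positivity, ?_⟩
  intro m _ _ H K hH hK τ hτ M
  have e : (M * (hH.funCalc (φ * ψ) - hK.funCalc (φ * ψ))).trace =
      ((M * hH.funCalc φ) * (hH.funCalc ψ - hK.funCalc ψ)).trace +
        ((hK.funCalc ψ * M) * (hH.funCalc φ - hK.funCalc φ)).trace := by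
    rw [mul_assoc (hK.funCalc ψ), trace_mul_comm (hK.funCalc ψ), ← trace_add,
      IsHermitian.funCalc_mul, IsHermitian.funCalc_mul]
    congr 1
    noncomm_ring
  rw [e]
  rcases isEmpty_or_nonempty m with hm | hm
  · simp [trace]
    have := tau_nonneg hτ M
    have h0 : 0 ≤ (D * a + C * b) * (τ * ‖M‖) := by positivity
    linarith
  have hM1 : ‖(1 : Matrix m m ℂ)‖ = 1 := CStarRing.norm_one
  have hτ0 : 0 ≤ τ := by simpa [hM1] using tau_nonneg hτ 1
  have h1 : ‖M * hH.funCalc φ‖ ≤ ‖M‖ * a := (norm_mul_le _ _).trans (by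
    gcongr; exact hH.norm_funCalc_le ha hφa)
  have h2 : ‖hK.funCalc ψ * M‖ ≤ b * ‖M‖ := (norm_mul_le _ _).trans (by
    gcongr; exact hK.norm_funCalc_le hb hψb)
  calc _ ≤ D * τ * (‖M‖ * a) + C * τ * (b * ‖M‖) := (norm_add_le _ _).trans
        (add_le_add ((hψD m H K hH hK τ hτ _).trans (by gcongr))
          ((hφC m H K hH hK τ hτ _).trans (by gcongr)))
    _ = _ := by ring

lemma ofReal_sub_I_ne_zero (x : ℝ) : (x : ℂ) - Complex.I ≠ 0 := by
  intro h
  simpa using congrArg Complex.im h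

lemma norm_resolvent_le (x : ℝ) : ‖((x : ℂ) - Complex.I)⁻¹‖ ≤ 1 := by
  rw [norm_inv]
  refine inv_le_one_of_one_le₀ ?_
  simpa using Complex.abs_im_le_norm ((x : ℂ) - Complex.I)

lemma resolvent : TraceLipschitz fun x => ((x : ℂ) - Complex.I)⁻¹ := by
  refine ⟨Continuous.inv₀ (by fun_prop) ofReal_sub_I_ne_zero, ⟨1, zero_le_one, norm_resolvent_le⟩,
    1, zero_le_one, ?_⟩
  intro m _ _ H K hH hK τ hτ M
  have key : ∀ {L : Matrix m m ℂ} (hL : L.IsHermitian),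
      (L - Complex.I • 1) * hL.funCalc (fun x => ((x : ℂ) - Complex.I)⁻¹) = 1 := by
    intro L hL
    have e : L - Complex.I • 1 = hL.funCalc (fun x => (x : ℂ) - Complex.I) := by
      have := hL.funCalc_add (fun x => (x : ℂ)) (fun _ => -Complex.I)
      rw [hL.funCalc_ofReal, hL.funCalc_const, neg_smul, ← sub_eq_add_neg] at this
      rw [← this]; rfl
    rw [e, ← IsHermitian.funCalc_mul]
    have : ((fun x : ℝ => (x : ℂ) - Complex.I) * fun x : ℝ => ((x : ℂ) - Complex.I)⁻¹) =
        fun _ => 1 := by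
      funext x
      exact mul_inv_cancel₀ (ofReal_sub_I_ne_zero x)
    rw [this, IsHermitian.funCalc_const, one_smul]
  set R := hH.funCalc (fun x => ((x : ℂ) - Complex.I)⁻¹)
  set S := hK.funCalc (fun x => ((x : ℂ) - Complex.I)⁻¹)
  have h1 : R * (H - Complex.I • 1) = 1 := mul_eq_one_comm.1 (key hH)
  have h2 : (K - Complex.I • 1) * S = 1 := key hK
  have e : R - S = -(R * (H - K) * S) := by
    have : R * (H - K) * S = R * (H - Complex.I • 1) * S - R * ((K - Complex.I • 1) * S) := by
      noncomm_ring
    rw [this, h1, h2]; simp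
  have e2 : (M * (R - S)).trace = -((S * M * R) * (H - K)).trace := by
    rw [e, mul_neg, trace_neg, ← mul_assoc, trace_mul_comm]
    simp only [mul_assoc]
  rw [e2, norm_neg]
  have hR : ‖R‖ ≤ 1 := hH.norm_funCalc_le zero_le_one norm_resolvent_le
  have hS : ‖S‖ ≤ 1 := hK.norm_funCalc_le zero_le_one norm_resolvent_le
  rcases isEmpty_or_nonempty m with hm | hm
  · simpa [trace] using tau_nonneg hτ M
  have hM1 : ‖(1 : Matrix m m ℂ)‖ = 1 := CStarRing.norm_one
  have hτ0 : 0 ≤ τ := by simpa [hM1] using tau_nonneg hτ 1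
  refine (hτ _).trans ?_
  rw [one_mul]
  gcongr
  calc ‖S * M * R‖ ≤ ‖S‖ * ‖M‖ * ‖R‖ := norm_mul₃_le
    _ ≤ 1 * ‖M‖ * 1 := by gcongr
    _ = ‖M‖ := by ring

lemma exists_near {φ : ℝ → ℂ} (hφ : Continuous φ) (hc : HasCompactSupport φ) {ε : ℝ}
    (hε : 0 < ε) : ∃ ψ, TraceLipschitz ψ ∧ ∀ x, ‖φ x - ψ x‖ ≤ ε := by
  have hr : Tendsto (fun x : ℝ => ((x : ℂ) - Complex.I)⁻¹) (coclosedCompact ℝ) (nhds 0) := by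
    rw [coclosedCompact_eq_cocompact]
    refine tendsto_inv₀_cobounded.comp ?_
    rw [← Metric.cobounded_eq_cocompact, tendsto_norm_atTop_iff_cobounded.symm]
    have : Tendsto (fun x : ℝ => ‖x‖ - 1) (Bornology.cobounded ℝ) atTop :=
      tendsto_atTop_add_const_right _ _ tendsto_norm_cobounded_atTop
    refine tendsto_atTop_mono (fun x => ?_) this
    simpa using norm_sub_norm_le (x : ℂ) Complex.I
  have hφ0 : Tendsto φ (coclosedCompact ℝ) (nhds 0) := by
    rw [coclosedCompact_eq_cocompact]
    exact hc.is_zero_at_infty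
  let r : C(OnePoint ℝ, ℂ) := OnePoint.continuousMapMk ⟨_, resolvent.continuous⟩ 0 hr
  let Φ : C(OnePoint ℝ, ℂ) := OnePoint.continuousMapMk ⟨φ, hφ⟩ 0 hφ0
  have hr0 : ∀ x : ℝ, r x = ((x : ℂ) - Complex.I)⁻¹ := fun x => rfl
  have hri : r OnePoint.infty = 0 := rfl
  have htop := ContinuousMap.starSubalgebra_topologicalClosure_eq_top_of_separatesPoints
    (StarAlgebra.adjoin ℂ {r}) (by
      intro x y hxy
      refine ⟨r, ⟨r, StarAlgebra.self_mem_adjoin_singleton ℂ r, rfl⟩, fun h => hxy ?_⟩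
      induction x using OnePoint.rec <;> induction y using OnePoint.rec
      · rfl
      · rw [hri, hr0] at h
        exact absurd h.symm (inv_ne_zero (ofReal_sub_I_ne_zero _))
      · rw [hri, hr0] at h
        exact absurd h (inv_ne_zero (ofReal_sub_I_ne_zero _))
      · rw [hr0, hr0] at h
        have := inv_injective h
        simpa using this)
  have hmem : Φ ∈ (StarAlgebra.adjoin ℂ {r}).topologicalClosure := by rw [htop]; trivial
  rw [← SetLike.mem_coe, StarSubalgebra.topologicalClosure_coe, Metric.mem_closure_iff] at hmem
  obtain ⟨g, hg, hgd⟩ := hmem ε hε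
  refine ⟨fun x => g x, ?_, fun x => ?_⟩
  · clear hgd
    refine StarAlgebra.adjoin_induction (p := fun g _ => TraceLipschitz fun x : ℝ => g x)
      ?_ ?_ ?_ ?_ ?_ hg
    · rintro _ rfl
      exact resolvent
    · exact fun c => const c
    · exact fun _ _ _ _ h1 h2 => h1.add h2
    · exact fun _ _ _ _ h1 h2 => h1.mul h2
    · exact fun _ _ h => h.star
  · rw [← dist_eq_norm]
    exact ((ContinuousMap.dist_apply_le_dist (f := Φ) (g := g) (x : OnePoint ℝ))).trans hgd.le

end TraceLipschitz

/-- The trigonometric polynomial `θ ↦ ∑ₖ cₖ e^{ikθ}`. -/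
noncomputable def trigPoly (c : ℤ →₀ ℂ) (θ : ℝ) : ℂ :=
  ∑ k ∈ c.support, c k * Complex.exp (Complex.I * k * θ)

section AddCircle

variable {T : ℝ} [hT : Fact (0 < T)]

lemma AddCircle.exists_fourier_sum_near (g : C(AddCircle T, ℂ)) {ε : ℝ} (hε : 0 < ε) :
    ∃ c : ℤ →₀ ℂ, ∀ x, ‖g x - ∑ k ∈ c.support, c k * fourier k x‖ ≤ ε := by
  have hg : g ∈ (Submodule.span ℂ (Set.range <| @fourier T)).topologicalClosure := by
    rw [span_fourier_closure_eq_top]; trivial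
  rw [← SetLike.mem_coe, Submodule.topologicalClosure_coe, Metric.mem_closure_iff] at hg
  obtain ⟨h, hh, hd⟩ := hg ε hε
  obtain ⟨c, rfl⟩ := Finsupp.mem_span_range_iff_exists_finsupp.1 hh
  refine ⟨c, fun x => ?_⟩
  rw [← dist_eq_norm]
  refine le_trans (le_of_eq ?_) ((ContinuousMap.dist_apply_le_dist x).trans hd.le)
  rw [Finsupp.sum, ContinuousMap.sum_apply]
  rfl

lemma AddCircle.exists_fourier_sum_integral_le {h : AddCircle T → ℂ} (hh : Integrable h) {ε : ℝ}
    (hε : 0 < ε) : ∃ c : ℤ →₀ ℂ, ∫ x, ‖h x - ∑ k ∈ c.support, c k * fourier k x‖ ≤ ε := by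
  obtain ⟨g, -, hgd, hgc, hgi⟩ := hh.exists_hasCompactSupport_integral_sub_le (half_pos hε)
  have hT' := hT.out
  obtain ⟨c, hc⟩ := AddCircle.exists_fourier_sum_near ⟨g, hgc⟩
    (ε := ε / (2 * T)) (by positivity)
  refine ⟨c, ?_⟩
  have hcont : Continuous fun x : AddCircle T => ∑ k ∈ c.support, c k * fourier k x := by fun_prop
  have hci : Integrable fun x : AddCircle T => ∑ k ∈ c.support, c k * fourier k x :=
    hcont.integrable_of_hasCompactSupport (HasCompactSupport.of_compactSpace _)
  calc _ ≤ ∫ x, (‖h x - g x‖ + ε / (2 * T)) := by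
        refine integral_mono (hh.sub hci).norm ((hh.sub hgi).norm.add (integrable_const _))
          fun x => ?_
        calc _ = ‖(h x - g x) + (g x - ∑ k ∈ c.support, c k * fourier k x)‖ := by ring_nf
          _ ≤ _ := (norm_add_le _ _).trans (add_le_add_right (hc x) _)
    _ = (∫ x, ‖h x - g x‖) + ε / 2 := by
        rw [integral_add (f := fun x => ‖h x - g x‖) (hh.sub hgi).norm (integrable_const _),
          integral_const,
          measureReal_def, AddCircle.measure_univ, ENNReal.toReal_ofReal hT'.le, smul_eq_mul]
        field_simp
    _ ≤ ε := by linarith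

lemma AddCircle.integral_mul_eq_zero {d : AddCircle T → ℂ} (hd : Integrable d)
    (h0 : ∀ k : ℤ, ∫ x, d x * fourier k x = 0) (φ : C(AddCircle T, ℂ)) :
    ∫ x, d x * φ x = 0 := by
  have hint : ∀ ψ : AddCircle T → ℂ, Continuous ψ → Integrable fun x => d x * ψ x := by
    intro ψ hψ
    obtain ⟨b, hb⟩ := isCompact_univ.exists_bound_of_continuousOn hψ.continuousOn
    exact hd.mul_bdd (c := b) hψ.aestronglyMeasurable (ae_of_all _ fun x => hb x trivial)
  rw [← norm_le_zero_iff]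
  refine le_of_forall_pos_le_add fun ε hε => ?_
  have hN : 0 ≤ ∫ x, ‖d x‖ := integral_nonneg fun x => norm_nonneg _
  obtain ⟨c, hc⟩ := AddCircle.exists_fourier_sum_near φ
    (ε := ε / ((∫ x, ‖d x‖) + 1)) (by positivity)
  have h1 : ∫ x, d x * ∑ k ∈ c.support, c k * fourier k x = 0 := by
    simp_rw [Finset.mul_sum]
    rw [integral_finsetSum _ fun k _ => hint _ (by fun_prop)]
    refine Finset.sum_eq_zero fun k _ => ?_
    simp_rw [mul_left_comm _ (c k)]
    rw [integral_const_mul, h0, mul_zero]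
  have h2 : ∫ x, d x * φ x = ∫ x, d x * (φ x - ∑ k ∈ c.support, c k * fourier k x) := by
    simp_rw [mul_sub]
    rw [integral_sub (hint _ φ.continuous) (hint _ (by fun_prop)), h1, sub_zero]
  rw [h2, zero_add]
  refine (norm_integral_le_integral_norm _).trans ?_
  calc _ ≤ ∫ x, ‖d x‖ * (ε / ((∫ x, ‖d x‖) + 1)) := by
        refine integral_mono (hint _ (by fun_prop)).norm (hd.norm.mul_const _) fun x => ?_
        rw [norm_mul]
        gcongr
        exact hc x
    _ = (∫ x, ‖d x‖) / ((∫ x, ‖d x‖) + 1) * ε := by rw [integral_mul_const]; ring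
    _ ≤ 1 * ε := by gcongr; rw [div_le_one (by positivity)]; linarith
    _ = ε := one_mul _

lemma AddCircle.ae_eq_zero_of_integral_mul_fourier {d : AddCircle T → ℂ} (hd : Integrable d)
    (h0 : ∀ k : ℤ, ∫ x, d x * fourier k x = 0) : d =ᵐ[volume] 0 := by
  have hT' := hT.out
  suffices h : ∫ x, ‖d x‖ ≤ 0 by
    have h' := (integral_eq_zero_iff_of_nonneg (fun x => norm_nonneg (d x)) hd.norm).1
      (le_antisymm h (integral_nonneg fun x => norm_nonneg _))
    filter_upwards [h'] with x hx
    simpa using hx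
  refine le_of_forall_pos_le_add fun ε hε => ?_
  obtain ⟨g, -, hgd, hgc, hgi⟩ :=
    hd.exists_hasCompactSupport_integral_sub_le (ε := ε / 4) (by positivity)
  set δ := ε / (4 * T) with hδ
  have hδ0 : 0 < δ := by positivity
  have hpos : ∀ x, 0 < ‖g x‖ + δ := fun x => by positivity
  have hne : ∀ x, ((‖g x‖ + δ : ℝ) : ℂ) ≠ 0 := fun x => by exact_mod_cast (hpos x).ne'
  let φ : C(AddCircle T, ℂ) := ⟨fun x => star (g x) / ((‖g x‖ + δ : ℝ) : ℂ),
    Continuous.div (by fun_prop) (by fun_prop) hne⟩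
  have hφ1 : ∀ x, ‖φ x‖ ≤ 1 := by
    intro x
    change ‖star (g x) / ((‖g x‖ + δ : ℝ) : ℂ)‖ ≤ 1
    rw [norm_div, norm_star, Complex.norm_real, Real.norm_of_nonneg (hpos x).le,
      div_le_one (hpos x)]
    linarith
  have hφg : ∀ x, ‖g x‖ - δ ≤ (g x * φ x).re := by
    intro x
    have e : g x * φ x = ((‖g x‖ ^ 2 / (‖g x‖ + δ) : ℝ) : ℂ) := by
      change g x * (star (g x) / ((‖g x‖ + δ : ℝ) : ℂ)) = _
      rw [← mul_div_assoc, Complex.star_def, Complex.mul_conj, Complex.normSq_eq_norm_sq]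
      push_cast; rfl
    rw [e, Complex.ofReal_re, le_div_iff₀ (hpos x)]
    nlinarith [sq_nonneg δ]
  have hgφ : Integrable fun x => g x * φ x :=
    hgi.mul_bdd (c := 1) φ.continuous.aestronglyMeasurable (ae_of_all _ hφ1)
  have hdφ : Integrable fun x => d x * φ x :=
    hd.mul_bdd (c := 1) φ.continuous.aestronglyMeasurable (ae_of_all _ hφ1)
  have h1 : ‖∫ x, g x * φ x‖ ≤ ε / 4 := by
    have e : ∫ x, g x * φ x = -∫ x, (d x - g x) * φ x := by
      simp_rw [sub_mul]
      rw [integral_sub hdφ hgφ, AddCircle.integral_mul_eq_zero hd h0 φ]; simp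
    rw [e, norm_neg]
    refine (norm_integral_le_integral_norm _).trans (le_trans ?_ hgd)
    refine integral_mono ((hd.sub hgi).mul_bdd (c := 1) φ.continuous.aestronglyMeasurable
      (ae_of_all _ hφ1)).norm (hd.sub hgi).norm fun x => ?_
    rw [norm_mul]
    exact mul_le_of_le_one_right (norm_nonneg _) (hφ1 x)
  have h2 : ∫ x, ‖g x‖ ≤ ε / 2 := by
    have h3 : ∫ x, (‖g x‖ - δ) ≤ ∫ x, (g x * φ x).re :=
      integral_mono (hgi.norm.sub (integrable_const _)) hgφ.re hφg
    rw [integral_sub hgi.norm (integrable_const _), integral_const, measureReal_def,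
      AddCircle.measure_univ, ENNReal.toReal_ofReal hT'.le, smul_eq_mul] at h3
    have h4 : ∫ x, (g x * φ x).re = (∫ x, g x * φ x).re := integral_re hgφ
    have h5 := (Complex.re_le_norm (∫ x, g x * φ x)).trans h1
    have h6 : T * δ = ε / 4 := by rw [hδ]; field_simp
    linarith
  calc ∫ x, ‖d x‖ ≤ ∫ x, (‖d x - g x‖ + ‖g x‖) :=
        integral_mono hd.norm ((hd.sub hgi).norm.add hgi.norm) fun x => by
          simpa using norm_add_le (d x - g x) (g x)
    _ = (∫ x, ‖d x - g x‖) + ∫ x, ‖g x‖ := integral_add (hd.sub hgi).norm hgi.norm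
    _ ≤ 0 + ε := by linarith

end AddCircle

section Interval

open Real

lemma fourier_coe_two_pi (k : ℤ) (θ : ℝ) :
    fourier k (θ : AddCircle (2 * π)) = Complex.exp (Complex.I * k * θ) := by
  rw [fourier_coe_apply]
  congr 1
  push_cast
  field_simp

lemma integrable_liftIoc {h : ℝ → ℂ} [Fact (0 < 2 * π)] (hh : IntegrableOn h (Set.Ioc (-π) π)) :
    Integrable (AddCircle.liftIoc (2 * π) (-π) h) := by
  rw [← memLp_one_iff_integrable]
  refine MemLp.memLp_liftIoc ?_
  rw [memLp_one_iff_integrable, show -π + 2 * π = π by ring]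
  exact hh

lemma exists_trigPoly_integral_le {h : ℝ → ℂ} (hh : IntegrableOn h (Set.Ioc (-π) π)) {ε : ℝ}
    (hε : 0 < ε) : ∃ c : ℤ →₀ ℂ, ∫ θ in (-π)..π, ‖h θ - trigPoly c θ‖ ≤ ε := by
  have : Fact (0 < 2 * π) := ⟨two_pi_pos⟩
  obtain ⟨c, hc⟩ := AddCircle.exists_fourier_sum_integral_le (integrable_liftIoc hh) hε
  refine ⟨c, le_trans (le_of_eq ?_) hc⟩
  rw [← AddCircle.intervalIntegral_preimage (2 * π) (-π), show -π + 2 * π = π by ring]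
  refine intervalIntegral.integral_congr_ae (ae_of_all _ fun θ hθ => ?_)
  rw [Set.uIoc_of_le (by linarith [pi_pos])] at hθ
  simp only [fourier_coe_two_pi]
  rw [AddCircle.liftIoc_coe_apply (by rwa [show -π + 2 * π = π by ring])]
  rfl

lemma ae_eq_zero_of_integral_mul_exp {d : ℝ → ℂ} (hd : IntegrableOn d (Set.Ioc (-π) π))
    (h0 : ∀ k : ℤ, ∫ θ in (-π)..π, d θ * Complex.exp (-Complex.I * k * θ) = 0) :
    ∀ᵐ θ ∂volume.restrict (Set.Ioc (-π) π), d θ = 0 := by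
  have : Fact (0 < 2 * π) := ⟨two_pi_pos⟩
  have hconv : ∀ F : AddCircle (2 * π) → ℂ, ∫ x, F x = ∫ θ in (-π)..π, F θ := by
    intro F
    rw [← AddCircle.intervalIntegral_preimage (2 * π) (-π), show -π + 2 * π = π by ring]
  have h1 := AddCircle.ae_eq_zero_of_integral_mul_fourier (integrable_liftIoc hd) (by
    intro k
    rw [hconv, ← h0 (-k)]
    refine intervalIntegral.integral_congr_ae (ae_of_all _ fun θ hθ => ?_)
    rw [Set.uIoc_of_le (by linarith [pi_pos])] at hθ
    rw [fourier_coe_two_pi, AddCircle.liftIoc_coe_apply (by rwa [show -π + 2 * π = π by ring])]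
    push_cast; ring_nf)
  have h2 := (AddCircle.measurePreserving_mk (2 * π) (-π)).quasiMeasurePreserving.ae h1
  rw [show -π + 2 * π = π by ring] at h2
  filter_upwards [h2, ae_restrict_mem measurableSet_Ioc] with θ hθ hm
  rwa [AddCircle.liftIoc_coe_apply (by rwa [show -π + 2 * π = π by ring])] at hθ

end Interval

/-- The Fourier coefficients of a matrix-valued function on `[-π, π]`. -/
noncomputable def blockFourierCoeff {s : ℕ} (f : ℝ → Matrix (Fin s) (Fin s) ℂ) (k : ℤ) :
    Matrix (Fin s) (Fin s) ℂ :=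
  of fun p q => (1 / (2 * Real.pi) : ℂ) *
    ∫ θ in (-Real.pi)..Real.pi, f θ p q * Complex.exp (-Complex.I * k * θ)

/-- The block Hankel matrix obtained by reversing the block rows of the block Toeplitz matrix with
blocks `A (j - k)`. -/
def flippedToeplitz {s : ℕ} (n : ℕ) (A : ℤ → Matrix (Fin s) (Fin s) ℂ) :
    Matrix (Fin n × Fin s) (Fin n × Fin s) ℂ :=
  of fun jp kq => A ((n : ℤ) - 1 - (jp.1 : ℕ) - (kq.1 : ℕ)) jp.2 kq.2

lemma flippedToeplitz_isHermitian {s : ℕ} (n : ℕ) {A : ℤ → Matrix (Fin s) (Fin s) ℂ}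
    (hA : ∀ k, (A k).IsHermitian) : (flippedToeplitz n A).IsHermitian := by
  ext jp kq
  simp only [flippedToeplitz, conjTranspose_apply, of_apply, (hA _).apply]
  ring_nf

lemma flippedToeplitz_sub {s : ℕ} (n : ℕ) (A B : ℤ → Matrix (Fin s) (Fin s) ℂ) :
    flippedToeplitz n (A - B) = flippedToeplitz n A - flippedToeplitz n B := by
  ext jp kq
  simp [flippedToeplitz]

lemma flip_mul_toeplitz {s n : ℕ} {A : ℤ → Matrix (Fin s) (Fin s) ℂ}
    {T Y : Matrix (Fin n × Fin s) (Fin n × Fin s) ℂ}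
    (hT : ∀ jp kq : Fin n × Fin s, T jp kq = A ((jp.1 : ℤ) - (kq.1 : ℤ)) jp.2 kq.2)
    (hY : ∀ jp kq : Fin n × Fin s,
      Y jp kq = if (jp.1 : ℕ) + (kq.1 : ℕ) + 1 = n ∧ jp.2 = kq.2 then 1 else 0) :
    Y * T = flippedToeplitz n A := by
  ext ⟨j, p⟩ ⟨k, q⟩
  rw [mul_apply, Finset.sum_eq_single (Fin.rev j, p)]
  · rw [hY, hT, if_pos ⟨by simp only [Fin.val_rev]; omega, rfl⟩, one_mul]
    simp only [flippedToeplitz, of_apply, Fin.val_rev]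
    congr 2
    omega
  · rintro ⟨l, r⟩ - hne
    rw [hY, if_neg, zero_mul]
    rintro ⟨h1, h2⟩
    refine hne (Prod.ext (Fin.ext ?_) h2.symm)
    simp only [Fin.val_rev] at h1 ⊢
    omega
  · simp

section TraceBound

open scoped Matrix.Norms.L2Operator

lemma norm_dotProduct_mulVec_le {m : Type*} [Fintype m] [DecidableEq m] (M : Matrix m m ℂ)
    (u v : m → ℂ) :
    ‖u ⬝ᵥ M *ᵥ v‖ ≤ ‖M‖ * (‖WithLp.toLp 2 u‖ * ‖WithLp.toLp 2 v‖) := by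
  have h1 : u ⬝ᵥ M *ᵥ v = inner ℂ (WithLp.toLp 2 (star u)) (WithLp.toLp 2 (M *ᵥ v)) := by
    rw [EuclideanSpace.inner_toLp_toLp, star_star, dotProduct_comm]
  have h2 : ‖WithLp.toLp 2 (star u)‖ = ‖WithLp.toLp 2 u‖ := by
    simp [EuclideanSpace.norm_eq]
  have h3 := l2_opNorm_mulVec M (WithLp.toLp 2 v)
  calc _ ≤ ‖WithLp.toLp 2 (star u)‖ * ‖WithLp.toLp 2 (M *ᵥ v)‖ := by
        rw [h1]; exact norm_inner_le_norm _ _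
    _ ≤ ‖WithLp.toLp 2 u‖ * (‖M‖ * ‖WithLp.toLp 2 v‖) := by rw [h2]; gcongr; exact h3
    _ = _ := by ring

lemma norm_sum_block_le {s n : ℕ} (M : Matrix (Fin n × Fin s) (Fin n × Fin s) ℂ) (p q : Fin s)
    (u v : Fin n → ℂ) (hu : ∀ j, ‖u j‖ = 1) (hv : ∀ j, ‖v j‖ = 1) :
    ‖∑ k, ∑ j, M (k, q) (j, p) * (u k * v j)‖ ≤ n * ‖M‖ := by
  have hnorm : ∀ (r : Fin s) (w : Fin n → ℂ), (∀ j, ‖w j‖ = 1) →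
      ‖WithLp.toLp 2 fun x : Fin n × Fin s => if x.2 = r then w x.1 else 0‖ = Real.sqrt n := by
    intro r w hw
    have h1 : ∀ (j : Fin n) (r' : Fin s), ‖if r' = r then w j else 0‖ ^ 2 =
        if r' = r then 1 else 0 := by
      intro j r'
      split_ifs <;> simp [hw]
    rw [EuclideanSpace.norm_eq, Fintype.sum_prod_type]
    simp only [h1, Finset.sum_ite_eq', Finset.mem_univ, if_true]
    simp
  let U : Fin n × Fin s → ℂ := fun x => if x.2 = q then u x.1 else 0
  let V : Fin n × Fin s → ℂ := fun x => if x.2 = p then v x.1 else 0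
  have hU : ‖WithLp.toLp 2 U‖ = Real.sqrt n := hnorm q u hu
  have hV : ‖WithLp.toLp 2 V‖ = Real.sqrt n := hnorm p v hv
  have e : ∑ k, ∑ j, M (k, q) (j, p) * (u k * v j) = U ⬝ᵥ M *ᵥ V := by
    simp only [dotProduct, mulVec, Fintype.sum_prod_type, U, V, mul_ite, mul_zero, ite_mul,
      zero_mul, Finset.sum_ite_eq', Finset.mem_univ, if_true, Finset.mul_sum]
    refine Finset.sum_congr rfl fun k _ => (Finset.sum_comm.trans ?_).symm
    simp only [Finset.sum_ite_eq', Finset.mem_univ, if_true]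
    exact Finset.sum_congr rfl fun j _ => by ring
  rw [e]
  refine (norm_dotProduct_mulVec_le M U V).trans (le_of_eq ?_)
  rw [hU, hV, Real.mul_self_sqrt (Nat.cast_nonneg n), mul_comm]

lemma norm_trace_mul_flippedToeplitz_le {s : ℕ} (n : ℕ) {h : ℝ → Matrix (Fin s) (Fin s) ℂ}
    (hh : ∀ p q, IntervalIntegrable (fun θ => h θ p q) volume (-Real.pi) Real.pi)
    (M : Matrix (Fin n × Fin s) (Fin n × Fin s) ℂ) :
    ‖(M * flippedToeplitz n (blockFourierCoeff h)).trace‖ ≤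
      n * (∑ p, ∑ q, ∫ θ in (-Real.pi)..Real.pi, ‖h θ p q‖) * ‖M‖ := by
  have hpi := Real.pi_pos
  have hint : ∀ p q (k : ℤ), IntervalIntegrable
      (fun θ : ℝ => h θ p q * Complex.exp (-Complex.I * k * θ)) volume (-Real.pi) Real.pi :=
    fun p q k => (hh p q).mul_continuousOn (Continuous.continuousOn (by fun_prop))
  have e : (M * flippedToeplitz n (blockFourierCoeff h)).trace = ∑ p, ∑ q,
      (1 / (2 * Real.pi) : ℂ) * ∫ θ in (-Real.pi)..Real.pi, h θ p q * ∑ k, ∑ j,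
        M (k, q) (j, p) * Complex.exp (-Complex.I * ((n : ℤ) - 1 - (j : ℕ) - (k : ℕ) : ℤ) * θ) := by
    have e1 : ∀ p q, ∫ θ in (-Real.pi)..Real.pi, h θ p q * ∑ k, ∑ j,
        M (k, q) (j, p) * Complex.exp (-Complex.I * ((n : ℤ) - 1 - (j : ℕ) - (k : ℕ) : ℤ) * θ) =
        ∑ k, ∑ j, M (k, q) (j, p) * ∫ θ in (-Real.pi)..Real.pi,
          h θ p q * Complex.exp (-Complex.I * ((n : ℤ) - 1 - (j : ℕ) - (k : ℕ) : ℤ) * θ) := by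
      intro p q
      simp_rw [Finset.mul_sum, mul_left_comm (h _ p q)]
      rw [intervalIntegral.integral_finsetSum fun k _ => by
        simpa only [Finset.sum_fn] using
          IntervalIntegrable.sum Finset.univ fun j _ => (hint p q _).const_mul (M (k, q) (j, p))]
      refine Finset.sum_congr rfl fun k _ => ?_
      rw [intervalIntegral.integral_finsetSum fun j _ => (hint p q _).const_mul _]
      simp_rw [intervalIntegral.integral_const_mul]
    simp_rw [e1, Finset.mul_sum]
    simp only [trace, diag_apply, mul_apply, Fintype.sum_prod_type, flippedToeplitz,
      blockFourierCoeff, of_apply]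
    rw [Finset.sum_comm]
    refine (Finset.sum_congr rfl fun q _ => Finset.sum_congr rfl fun k _ =>
      Finset.sum_comm).trans ?_
    refine (Finset.sum_congr rfl fun q _ => Finset.sum_comm).trans ?_
    rw [Finset.sum_comm]
    refine Finset.sum_congr rfl fun p _ => Finset.sum_congr rfl fun q _ =>
      Finset.sum_congr rfl fun k _ => Finset.sum_congr rfl fun j _ => ?_
    ring
  rw [e, Finset.mul_sum, Finset.sum_mul]
  refine (norm_sum_le _ _).trans (Finset.sum_le_sum fun p _ => ?_)
  rw [Finset.mul_sum, Finset.sum_mul]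
  refine (norm_sum_le _ _).trans (Finset.sum_le_sum fun q _ => ?_)
  have hc : ‖(1 / (2 * Real.pi) : ℂ)‖ ≤ 1 := by
    rw [norm_div, norm_mul, Complex.norm_real, Real.norm_of_nonneg hpi.le]
    simp only [norm_one, Complex.norm_ofNat]
    rw [div_le_one (by positivity)]
    linarith [Real.pi_gt_three]
  have hb : ∀ θ : ℝ, ‖∑ k : Fin n, ∑ j : Fin n, M (k, q) (j, p) *
      Complex.exp (-Complex.I * ((n : ℤ) - 1 - (j : ℕ) - (k : ℕ) : ℤ) * θ)‖ ≤ n * ‖M‖ := by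
    intro θ
    have hnorm : ∀ z : ℤ, ‖Complex.exp (Complex.I * z * θ)‖ = 1 := fun z => by
      rw [show Complex.I * z * θ = ((z * θ : ℝ) : ℂ) * Complex.I by push_cast; ring,
        Complex.norm_exp_ofReal_mul_I]
    have := norm_sum_block_le M p q
      (fun k => Complex.exp (Complex.I * ((k : ℕ) : ℤ) * θ))
      (fun j => Complex.exp (Complex.I * (((j : ℕ) : ℤ) + 1 - (n : ℤ) : ℤ) * θ))
      (fun _ => hnorm _) (fun _ => hnorm _)
    refine le_trans (le_of_eq ?_) this
    congr 1
    refine Finset.sum_congr rfl fun k _ => Finset.sum_congr rfl fun j _ => ?_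
    rw [← Complex.exp_add]
    push_cast
    ring_nf
  rw [norm_mul]
  calc _ ≤ 1 * ∫ θ in (-Real.pi)..Real.pi, ‖h θ p q‖ * (n * ‖M‖) := by
        gcongr
        refine intervalIntegral.norm_integral_le_of_norm_le (by linarith)
          (ae_of_all _ fun θ _ => ?_) ((hh p q).norm.mul_const _)
        rw [norm_mul]
        gcongr
        exact hb θ
    _ = _ := by rw [intervalIntegral.integral_mul_const]; ring

end TraceBound

section Moments

variable {s : ℕ}

/-- The matrix-valued trigonometric polynomial `θ ↦ ∑ A k e^{ikθ}`, summed over `|k| ≤ r`. -/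
noncomputable def trigSymbol (A : ℤ → Matrix (Fin s) (Fin s) ℂ) (r : ℕ) (θ : ℝ) :
    Matrix (Fin s) (Fin s) ℂ :=
  ∑ k ∈ Finset.Icc (-(r : ℤ)) r, Complex.exp (Complex.I * k * θ) • A k

lemma continuous_trigSymbol (A : ℤ → Matrix (Fin s) (Fin s) ℂ) (r : ℕ) :
    Continuous (trigSymbol A r) := by
  unfold trigSymbol
  fun_prop

lemma trigSymbol_neg {A : ℤ → Matrix (Fin s) (Fin s) ℂ} (hA : ∀ k, (A k).IsHermitian) (r : ℕ)
    (θ : ℝ) : trigSymbol A r (-θ) = (trigSymbol A r θ)ᴴ := by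
  rw [trigSymbol, trigSymbol, conjTranspose_sum]
  refine Finset.sum_congr rfl fun k _ => ?_
  rw [conjTranspose_smul, (hA k).eq, Complex.star_def, ← Complex.exp_conj]
  congr 2
  simp

lemma integral_exp_int_mul (z : ℤ) :
    ∫ θ in (-Real.pi)..Real.pi, Complex.exp (Complex.I * z * θ) =
      if z = 0 then (2 * Real.pi : ℂ) else 0 := by
  split_ifs with h
  · subst h
    simp [two_mul]
  · have hc : Complex.I * z ≠ 0 := mul_ne_zero Complex.I_ne_zero (by exact_mod_cast h)
    rw [integral_exp_mul_complex hc, div_eq_zero_iff, sub_eq_zero]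
    refine Or.inl (Complex.exp_eq_exp_iff_exists_int.2 ⟨z, ?_⟩)
    push_cast
    ring

/-- Two block vectors agree outside the first and last `d` blocks. -/
def AgreeOnBulk {n : ℕ} (d : ℕ) (V W : Matrix (Fin n × Fin s) (Fin s) ℂ) : Prop :=
  ∀ (j : Fin n) (p q : Fin s), d ≤ (j : ℕ) → (j : ℕ) + d < n → V (j, p) q = W (j, p) q

lemma AgreeOnBulk.trans {n d e : ℕ} {U V W : Matrix (Fin n × Fin s) (Fin s) ℂ}
    (h1 : AgreeOnBulk d U V) (h2 : AgreeOnBulk e V W) (hed : e ≤ d) : AgreeOnBulk d U W :=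
  fun j p q hj hj' => (h1 j p q hj hj').trans (h2 j p q (by omega) (by omega))

lemma AgreeOnBulk.flippedToeplitz_mul {n d r : ℕ} {A : ℤ → Matrix (Fin s) (Fin s) ℂ}
    (hA : ∀ k, (r : ℤ) < |k| → A k = 0) {V W : Matrix (Fin n × Fin s) (Fin s) ℂ}
    (h : AgreeOnBulk d V W) :
    AgreeOnBulk (d + r) (flippedToeplitz n A * V) (flippedToeplitz n A * W) := by
  intro j p q hj hj'
  rw [mul_apply, mul_apply]
  refine Finset.sum_congr rfl fun ⟨k, p'⟩ _ => ?_
  by_cases hk : d ≤ (k : ℕ) ∧ (k : ℕ) + d < n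
  · rw [h k p' q hk.1 hk.2]
  · have : flippedToeplitz n A (j, p) (k, p') = 0 := by
      have := k.2
      simp only [flippedToeplitz, of_apply]
      rw [hA _ (by rw [lt_abs]; omega), Matrix.zero_apply]
    rw [this, zero_mul, zero_mul]

/-- The block plane wave with frequency `θ` and amplitude `W`. -/
noncomputable def blockWave (n : ℕ) (θ : ℝ) (W : Matrix (Fin s) (Fin s) ℂ) :
    Matrix (Fin n × Fin s) (Fin s) ℂ :=
  of fun jp q => Complex.exp (Complex.I * (jp.1 : ℕ) * θ) * W jp.2 q

lemma sum_fin_sub_eq_sum_Icc {M : Type*} [AddCommMonoid M] {n r : ℕ} {ψ : ℤ → M}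
    (hψ : ∀ k, (r : ℤ) < |k| → ψ k = 0) {c : ℤ} (hc : r ≤ c) (hcn : c + r < n) :
    ∑ k : Fin n, ψ (c - (k : ℕ)) = ∑ m ∈ Finset.Icc (-(r : ℤ)) r, ψ m := by
  have h1 : ∑ k : Fin n, ψ (c - (k : ℕ)) = ∑ m ∈ Finset.Icc (c - n + 1) c, ψ m := by
    refine Finset.sum_nbij (fun k : Fin n => c - (k : ℕ)) ?_ ?_ ?_ fun _ _ => rfl
    · intro k _
      rw [Finset.mem_Icc]
      have := k.2
      omega
    · intro k _ l _ hkl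
      simp only at hkl
      exact Fin.ext (by omega)
    · intro m hm
      rw [Finset.mem_coe, Finset.mem_Icc] at hm
      refine ⟨⟨(c - m).toNat, by omega⟩, Finset.mem_coe.2 (Finset.mem_univ _), ?_⟩
      simp only
      omega
  rw [h1]
  refine (Finset.sum_subset (Finset.Icc_subset_Icc (by omega) (by omega)) fun m _ hm => ?_).symm
  rw [Finset.mem_Icc] at hm
  exact hψ m (by rw [lt_abs]; omega)

lemma flippedToeplitz_mul_blockWave {n r : ℕ} {A : ℤ → Matrix (Fin s) (Fin s) ℂ}
    (hA : ∀ k, (r : ℤ) < |k| → A k = 0) (θ : ℝ) (W : Matrix (Fin s) (Fin s) ℂ) :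
    AgreeOnBulk r (flippedToeplitz n A * blockWave n θ W)
      (blockWave n (-θ)
        (Complex.exp (Complex.I * ((n : ℂ) - 1) * θ) • (trigSymbol A r (-θ) * W))) := by
  intro j p q hj hj'
  have key := sum_fin_sub_eq_sum_Icc (n := n) (r := r)
    (ψ := fun m => ∑ p', Complex.exp (Complex.I * (((n : ℤ) - 1 - (j : ℕ) - m : ℤ)) * θ) *
      A m p p' * W p' q) (fun k hk => by simp [hA k hk]) (c := (n : ℤ) - 1 - (j : ℕ))
      (by omega) (by omega)
  rw [mul_apply, Fintype.sum_prod_type]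
  simp only [flippedToeplitz, blockWave, of_apply, Matrix.smul_apply, smul_eq_mul, mul_apply,
    trigSymbol,
    Matrix.sum_apply]
  calc _ = _ := Finset.sum_congr rfl fun k _ => Finset.sum_congr rfl fun p' _ => by
        rw [show ((n : ℤ) - 1 - (j : ℕ) - ((n : ℤ) - 1 - (j : ℕ) - (k : ℕ)) : ℤ) = (k : ℕ) by ring]
        push_cast
        ring
    _ = _ := key
    _ = _ := by
        rw [Finset.sum_comm]
        simp only [Finset.mul_sum, Finset.sum_mul]
        refine Finset.sum_congr rfl fun p' _ => Finset.sum_congr rfl fun m _ => ?_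
        have e : Complex.exp (Complex.I * (((n : ℤ) - 1 - (j : ℕ) - m : ℤ)) * θ) =
            Complex.exp (Complex.I * (j : ℕ) * (-θ : ℝ)) *
              (Complex.exp (Complex.I * ((n : ℂ) - 1) * θ) *
                Complex.exp (Complex.I * m * (-θ : ℝ))) := by
          rw [← Complex.exp_add, ← Complex.exp_add]
          congr 1
          push_cast
          ring
        rw [e]
        ring

lemma flippedToeplitz_pow_mul_blockWave {n r : ℕ} {A : ℤ → Matrix (Fin s) (Fin s) ℂ}
    (hA : ∀ k, (r : ℤ) < |k| → A k = 0) (θ : ℝ) (k : ℕ) :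
    AgreeOnBulk (2 * k * r) (flippedToeplitz n A ^ (2 * k) * blockWave n θ
      (1 : Matrix (Fin s) (Fin s) ℂ))
      (blockWave n θ ((trigSymbol A r θ * trigSymbol A r (-θ)) ^ k)) := by
  induction k with
  | zero => intro j p q _ _; simp
  | succ k ih =>
    set P := (trigSymbol A r θ * trigSymbol A r (-θ)) ^ k with hP
    have h1 := ((ih.flippedToeplitz_mul hA).trans
      (flippedToeplitz_mul_blockWave hA θ P) (by omega)).flippedToeplitz_mul hA
    have h2 := h1.trans (flippedToeplitz_mul_blockWave hA (-θ) _) (by omega)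
    have e1 : flippedToeplitz n A ^ (2 * (k + 1)) * blockWave n θ (1 : Matrix (Fin s) (Fin s) ℂ) =
        flippedToeplitz n A *
          (flippedToeplitz n A *
            (flippedToeplitz n A ^ (2 * k) * blockWave n θ (1 : Matrix (Fin s) (Fin s) ℂ))) := by
      rw [← Matrix.mul_assoc, ← Matrix.mul_assoc, ← pow_two, ← pow_add]
      congr 2
      ring
    have e2 : Complex.exp (Complex.I * ((n : ℂ) - 1) * (-θ : ℝ)) • (trigSymbol A r (- -θ) *
          Complex.exp (Complex.I * ((n : ℂ) - 1) * θ) • (trigSymbol A r (-θ) * P)) =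
        (trigSymbol A r θ * trigSymbol A r (-θ)) ^ (k + 1) := by
      rw [mul_smul_comm, smul_smul, ← Complex.exp_add, neg_neg, pow_succ', ← hP,
        mul_assoc (trigSymbol A r θ)]
      rw [show Complex.I * ((n : ℂ) - 1) * (-θ : ℝ) + Complex.I * ((n : ℂ) - 1) * θ = 0 by
        push_cast; ring, Complex.exp_zero, one_smul]
    rw [e1, ← e2]
    rw [neg_neg] at h2 ⊢
    rwa [show 2 * (k + 1) * r = 2 * k * r + r + r by ring]

lemma integral_mul_blockWave {n : ℕ} (G : Matrix (Fin n × Fin s) (Fin n × Fin s) ℂ) (j : Fin n)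
    (p q : Fin s) :
    ∫ θ in (-Real.pi)..Real.pi,
      Complex.exp (-Complex.I * (j : ℕ) * θ) *
        (G * blockWave n θ (1 : Matrix (Fin s) (Fin s) ℂ) :
          Matrix (Fin n × Fin s) (Fin s) ℂ) (j, p) q =
      2 * Real.pi * G (j, p) (j, q) := by
  have e : ∀ θ : ℝ, Complex.exp (-Complex.I * (j : ℕ) * θ) *
        (G * blockWave n θ (1 : Matrix (Fin s) (Fin s) ℂ) :
          Matrix (Fin n × Fin s) (Fin s) ℂ) (j, p) q =
      ∑ l : Fin n, G (j, p) (l, q) *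
        Complex.exp (Complex.I * (((l : ℕ) : ℤ) - ((j : ℕ) : ℤ) : ℤ) * θ) := by
    intro θ
    simp only [mul_apply, Fintype.sum_prod_type, blockWave, of_apply, one_apply, mul_ite, mul_one,
      mul_zero, Finset.sum_ite_eq', Finset.mem_univ, if_true, Finset.mul_sum]
    refine Finset.sum_congr rfl fun l _ => ?_
    rw [mul_left_comm, ← Complex.exp_add]
    congr 2
    push_cast
    ring
  simp_rw [e]
  rw [intervalIntegral.integral_finsetSum fun l _ =>
    (Continuous.intervalIntegrable (by fun_prop) _ _)]
  simp_rw [intervalIntegral.integral_const_mul, integral_exp_int_mul]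
  rw [Finset.sum_eq_single j]
  · simp [mul_comm]
  · intro l _ hl
    rw [if_neg, mul_zero]
    intro h
    exact hl (Fin.ext (by omega))
  · simp

lemma flippedToeplitz_pow_diag {n r : ℕ} {A : ℤ → Matrix (Fin s) (Fin s) ℂ}
    (hA : ∀ k, (r : ℤ) < |k| → A k = 0) (k : ℕ) (j : Fin n) (hj : 2 * k * r ≤ (j : ℕ))
    (hj' : (j : ℕ) + 2 * k * r < n) (p : Fin s) :
    (flippedToeplitz n A ^ (2 * k)) (j, p) (j, p) = (1 / (2 * Real.pi) : ℂ) *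
      ∫ θ in (-Real.pi)..Real.pi, ((trigSymbol A r θ * trigSymbol A r (-θ)) ^ k) p p := by
  have hpi : (Real.pi : ℂ) ≠ 0 := by exact_mod_cast Real.pi_ne_zero
  have h := integral_mul_blockWave (flippedToeplitz n A ^ (2 * k)) j p p
  have e : ∀ θ : ℝ, Complex.exp (-Complex.I * (j : ℕ) * θ) *
      (flippedToeplitz n A ^ (2 * k) * blockWave n θ (1 : Matrix (Fin s) (Fin s) ℂ) :
        Matrix (Fin n × Fin s) (Fin s) ℂ) (j, p) p =
      ((trigSymbol A r θ * trigSymbol A r (-θ)) ^ k) p p := by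
    intro θ
    rw [flippedToeplitz_pow_mul_blockWave hA θ k j p p hj hj', blockWave, of_apply, ← mul_assoc,
      ← Complex.exp_add]
    ring_nf
    simp
  simp_rw [e] at h
  rw [h]
  field_simp

lemma flippedToeplitz_pow_eq_zero {n r : ℕ} {A : ℤ → Matrix (Fin s) (Fin s) ℂ}
    (hA : ∀ k, (r : ℤ) < |k| → A k = 0) (k : ℕ) (j l : Fin n) (p q : Fin s) :
    ((2 * k * r : ℕ) < |((j : ℕ) : ℤ) - (l : ℕ)| →
      (flippedToeplitz n A ^ (2 * k)) (j, p) (l, q) = 0) ∧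
    (((2 * k + 1) * r : ℕ) < |(n : ℤ) - 1 - (j : ℕ) - (l : ℕ)| →
      (flippedToeplitz n A ^ (2 * k + 1)) (j, p) (l, q) = 0) := by
  have hG : ∀ (i l : Fin n) (p q : Fin s), (r : ℤ) < |(n : ℤ) - 1 - (i : ℕ) - (l : ℕ)| →
      flippedToeplitz n A (i, p) (l, q) = 0 := by
    intro i l p q h
    simp only [flippedToeplitz, of_apply]
    rw [hA _ h, Matrix.zero_apply]
  have hodd : ∀ k, (∀ (j l : Fin n) (p q : Fin s),
      (2 * k * r : ℕ) < |((j : ℕ) : ℤ) - (l : ℕ)| →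
        (flippedToeplitz n A ^ (2 * k)) (j, p) (l, q) = 0) →
      ∀ (j l : Fin n) (p q : Fin s),
      ((2 * k + 1) * r : ℕ) < |(n : ℤ) - 1 - (j : ℕ) - (l : ℕ)| →
        (flippedToeplitz n A ^ (2 * k + 1)) (j, p) (l, q) = 0 := by
    intro k ih j l p q h
    rw [pow_succ, mul_apply]
    refine Finset.sum_eq_zero fun ⟨i, p'⟩ _ => ?_
    by_cases hi : (2 * k * r : ℕ) < |((j : ℕ) : ℤ) - (i : ℕ)|
    · rw [ih j i p p' hi, zero_mul]
    · rw [hG i l p' q, mul_zero]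
      rw [add_mul, one_mul] at h
      push_cast at h hi
      rw [lt_abs] at h hi ⊢
      omega
  have heven : ∀ k, ∀ (j l : Fin n) (p q : Fin s),
      (2 * k * r : ℕ) < |((j : ℕ) : ℤ) - (l : ℕ)| →
        (flippedToeplitz n A ^ (2 * k)) (j, p) (l, q) = 0 := by
    intro k
    induction k with
    | zero =>
      intro j l p q h
      have : (j, p) ≠ (l, q) := by
        intro e
        rw [Prod.mk.injEq] at e
        simp [e.1] at h
      simp [one_apply, this]
    | succ k ih =>
      intro j l p q h
      rw [show 2 * (k + 1) = (2 * k + 1) + 1 by ring, pow_succ, mul_apply]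
      refine Finset.sum_eq_zero fun ⟨i, p'⟩ _ => ?_
      by_cases hi : ((2 * k + 1) * r : ℕ) < |(n : ℤ) - 1 - (j : ℕ) - (i : ℕ)|
      · rw [hodd k ih j i p p' hi, zero_mul]
      · rw [hG i l p' q, mul_zero]
        rw [show 2 * (k + 1) * r = (2 * k + 1) * r + r by ring] at h
        push_cast at h hi
        rw [lt_abs] at h hi ⊢
        omega
  exact ⟨heven k j l p q, hodd k (heven k) j l p q⟩

lemma sum_norm_pow_le {m : Type*} [Fintype m] [DecidableEq m] {G : Matrix m m ℂ} {C : ℝ}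
    (hC : 0 ≤ C) (hG : ∀ a, ∑ b, ‖G a b‖ ≤ C) (k : ℕ) (a : m) : ∑ b, ‖(G ^ k) a b‖ ≤ C ^ k := by
  induction k generalizing a with
  | zero => simp [one_apply, apply_ite]
  | succ k ih =>
    rw [pow_succ']
    calc _ ≤ ∑ b, ∑ c, ‖G a c‖ * ‖(G ^ k) c b‖ := Finset.sum_le_sum fun b _ => by
          rw [mul_apply]
          refine (norm_sum_le _ _).trans_eq ?_
          simp_rw [norm_mul]
      _ = ∑ c, ‖G a c‖ * ∑ b, ‖(G ^ k) c b‖ := by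
          rw [Finset.sum_comm]; simp_rw [Finset.mul_sum]
      _ ≤ ∑ c, ‖G a c‖ * C ^ k := by gcongr; exact ih _
      _ = (∑ c, ‖G a c‖) * C ^ k := by rw [Finset.sum_mul]
      _ ≤ C * C ^ k := by gcongr; exact hG a
      _ = C ^ (k + 1) := by ring

lemma norm_pow_apply_le {m : Type*} [Fintype m] [DecidableEq m] {G : Matrix m m ℂ} {C : ℝ}
    (hC : 0 ≤ C) (hG : ∀ a, ∑ b, ‖G a b‖ ≤ C) (k : ℕ) (a b : m) : ‖(G ^ k) a b‖ ≤ C ^ k :=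
  (Finset.single_le_sum (f := fun b => ‖(G ^ k) a b‖) (fun _ _ => norm_nonneg _)
    (Finset.mem_univ b)).trans (sum_norm_pow_le hC hG k a)

lemma Matrix.IsHermitian.abs_eigenvalues_le {m : Type*} [Fintype m] [DecidableEq m]
    {G : Matrix m m ℂ} (hG : G.IsHermitian) {C : ℝ} (hC : ∀ a, ∑ b, ‖G a b‖ ≤ C) (j : m) :
    |hG.eigenvalues j| ≤ C := by
  have h : Module.End.HasEigenvalue (Matrix.toLin' G) (hG.eigenvalues j : ℂ) := by
    refine Module.End.hasEigenvalue_of_hasEigenvector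
      (x := WithLp.ofLp (hG.eigenvectorBasis j)) ⟨?_, ?_⟩
    · rw [Module.End.mem_eigenspace_iff, toLin'_apply, hG.mulVec_eigenvectorBasis]
      rfl
    · intro h0
      exact hG.eigenvectorBasis.orthonormal.ne_zero j (WithLp.ofLp_injective 2 h0)
  obtain ⟨k, hk⟩ := eigenvalue_mem_ball h
  rw [Metric.mem_closedBall, dist_eq_norm] at hk
  have h1 : ‖G k k‖ + ∑ b ∈ Finset.univ.erase k, ‖G k b‖ = ∑ b, ‖G k b‖ :=
    Finset.add_sum_erase _ (fun b => ‖G k b‖) (Finset.mem_univ k)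
  have h2 : ‖(hG.eigenvalues j : ℂ)‖ ≤ ‖(hG.eigenvalues j : ℂ) - G k k‖ + ‖G k k‖ := by
    simpa using norm_add_le ((hG.eigenvalues j : ℂ) - G k k) (G k k)
  rw [Complex.norm_real, Real.norm_eq_abs] at h2
  linarith [hC k]

end Moments

lemma tendsto_of_forall_exists_near {a : ℕ → ℂ} {L : ℂ}
    (h : ∀ ε : ℝ, 0 < ε → ∃ (b : ℕ → ℂ) (L' : ℂ), Tendsto b atTop (nhds L') ∧
      (∀ n, ‖a n - b n‖ ≤ ε) ∧ ‖L - L'‖ ≤ ε) : Tendsto a atTop (nhds L) := by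
  rw [Metric.tendsto_atTop]
  intro ε hε
  obtain ⟨b, L', hb, hab, hL⟩ := h (ε / 4) (by positivity)
  obtain ⟨N, hN⟩ := Metric.tendsto_atTop.1 hb (ε / 4) (by positivity)
  refine ⟨N, fun n hn => ?_⟩
  have h1 := hN n hn
  have h2 := hab n
  rw [← dist_eq_norm] at h2 hL
  rw [dist_comm] at hL
  linarith [dist_triangle4 (a n) (b n) L' L]

lemma tendsto_inv_mul_sum_fin {a : (n : ℕ) → Fin n → ℂ} {L : ℂ} {B : ℝ} {K : ℕ}
    (ha : ∀ n j, ‖a n j‖ ≤ B)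
    (hE : ∀ n, ∃ E : Finset (Fin n), E.card ≤ K ∧ ∀ j, j ∉ E → a n j = L) :
    Tendsto (fun n : ℕ => (n : ℂ)⁻¹ * ∑ j, a n j) atTop (nhds L) := by
  rw [tendsto_iff_norm_sub_tendsto_zero]
  have hlim : Tendsto (fun n : ℕ => (n : ℝ)⁻¹ * (K * (|B| + ‖L‖))) atTop (nhds 0) := by
    simpa using tendsto_inv_atTop_nhds_zero_nat.mul_const ((K : ℝ) * (|B| + ‖L‖))
  refine squeeze_zero' (Eventually.of_forall fun _ => norm_nonneg _) ?_ hlim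
  filter_upwards [eventually_ge_atTop 1] with n hn
  have hn' : (n : ℂ) ≠ 0 := by exact_mod_cast (show n ≠ 0 by omega)
  obtain ⟨E, hEK, hEL⟩ := hE n
  have e : (n : ℂ)⁻¹ * ∑ j, a n j - L = (n : ℂ)⁻¹ * ∑ j ∈ E, (a n j - L) := by
    rw [Finset.sum_subset (Finset.subset_univ E) fun j _ hj => by rw [hEL j hj, sub_self],
      Finset.sum_sub_distrib, mul_sub]
    simp [hn']
  rw [e, norm_mul, norm_inv, Complex.norm_natCast]
  gcongr
  calc _ ≤ ∑ j ∈ E, (|B| + ‖L‖) := norm_sum_le_of_le _ fun j _ =>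
        (norm_sub_le _ _).trans (by gcongr; exact (ha n j).trans (le_abs_self B))
    _ ≤ _ := by
        rw [Finset.sum_const, nsmul_eq_mul]
        gcongr

lemma exists_polynomial_norm_sub_le {φ : ℝ → ℂ} (hφ : Continuous φ) (C : ℝ) {ε : ℝ} (hε : 0 < ε) :
    ∃ p : Polynomial ℂ, ∀ x : ℝ, |x| ≤ C → ‖φ x - p.eval (x : ℂ)‖ ≤ ε := by
  obtain ⟨p, hp⟩ := exists_polynomial_near_of_continuousOn (-C) C (fun x => (φ x).re)
    (by fun_prop) (ε / 2) (by positivity)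
  obtain ⟨q, hq⟩ := exists_polynomial_near_of_continuousOn (-C) C (fun x => (φ x).im)
    (by fun_prop) (ε / 2) (by positivity)
  refine ⟨p.map Complex.ofRealHom + Polynomial.C Complex.I * q.map Complex.ofRealHom,
    fun x hx => ?_⟩
  have hx' := abs_le.1 hx
  have e : φ x - (p.map Complex.ofRealHom +
      Polynomial.C Complex.I * q.map Complex.ofRealHom).eval (x : ℂ) =
      (((φ x).re - p.eval x : ℝ) : ℂ) + Complex.I * (((φ x).im - q.eval x : ℝ) : ℂ) := by
    have h : ∀ r : Polynomial ℝ, (r.map Complex.ofRealHom).eval (x : ℂ) = ((r.eval x : ℝ) : ℂ) :=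
      fun r => Polynomial.eval_map_apply Complex.ofRealHom x
    conv_lhs => rw [← Complex.re_add_im (φ x)]
    simp only [Polynomial.eval_add, Polynomial.eval_mul, Polynomial.eval_C, h]
    push_cast
    ring
  rw [e]
  refine (norm_add_le _ _).trans ?_
  rw [norm_mul, Complex.norm_I, one_mul, Complex.norm_real, Complex.norm_real, Real.norm_eq_abs,
    Real.norm_eq_abs, abs_sub_comm, abs_sub_comm _ (q.eval x)]
  linarith [hp x hx', hq x hx']

section SymmetricMean

variable {s : ℕ}

/-- The average of an even extension of `φ` over the singular values of `G`. -/
noncomputable def symmetricMean (φ : ℝ → ℂ) (G : Matrix (Fin s) (Fin s) ℂ) : ℂ :=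
  (s : ℂ)⁻¹ * ∑ j, (φ (absEigenvalues G j) + φ (-absEigenvalues G j))

lemma symmetricMean_add (φ ψ : ℝ → ℂ) (G : Matrix (Fin s) (Fin s) ℂ) :
    symmetricMean (φ + ψ) G = symmetricMean φ G + symmetricMean ψ G := by
  simp only [symmetricMean, Pi.add_apply, ← mul_add, ← Finset.sum_add_distrib]
  congr 1
  exact Finset.sum_congr rfl fun j _ => by ring

lemma symmetricMean_const_mul (c : ℂ) (φ : ℝ → ℂ) (G : Matrix (Fin s) (Fin s) ℂ) :
    symmetricMean (fun x => c * φ x) G = c * symmetricMean φ G := by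
  simp only [symmetricMean, ← mul_add, ← Finset.mul_sum]
  ring

lemma norm_symmetricMean_sub_le {φ ψ : ℝ → ℂ} {ε : ℝ} (hε : 0 ≤ ε) {G : Matrix (Fin s) (Fin s) ℂ}
    (h : ∀ j, ∀ x : ℝ, |x| ≤ absEigenvalues G j → ‖φ x - ψ x‖ ≤ ε) :
    ‖symmetricMean φ G - symmetricMean ψ G‖ ≤ 2 * ε := by
  have h0 : ∀ j, 0 ≤ absEigenvalues G j := fun j => Real.sqrt_nonneg _
  rw [symmetricMean, symmetricMean, ← mul_sub, ← Finset.sum_sub_distrib, norm_mul, norm_inv,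
    Complex.norm_natCast]
  have h1 : ‖∑ j, (φ (absEigenvalues G j) + φ (-absEigenvalues G j) -
      (ψ (absEigenvalues G j) + ψ (-absEigenvalues G j)))‖ ≤ ∑ _j : Fin s, 2 * ε := by
    refine norm_sum_le_of_le _ fun j _ => ?_
    rw [add_sub_add_comm, two_mul]
    refine (norm_add_le _ _).trans (add_le_add (h j _ ?_) (h j _ ?_))
    · rw [abs_of_nonneg (h0 j)]
    · rw [abs_neg, abs_of_nonneg (h0 j)]
  rw [Finset.sum_const, Finset.card_univ, Fintype.card_fin, nsmul_eq_mul] at h1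
  calc _ ≤ (s : ℝ)⁻¹ * (s * (2 * ε)) := by gcongr
    _ = ((s : ℝ)⁻¹ * s) * (2 * ε) := by ring
    _ ≤ 1 * (2 * ε) := by gcongr; exact inv_mul_le_one
    _ = _ := one_mul _

lemma norm_symmetricMean_le {φ : ℝ → ℂ} {b : ℝ} (hb : 0 ≤ b) (h : ∀ x, ‖φ x‖ ≤ b)
    (G : Matrix (Fin s) (Fin s) ℂ) : ‖symmetricMean φ G‖ ≤ 2 * b := by
  have := norm_symmetricMean_sub_le (φ := φ) (ψ := fun _ => 0) hb (G := G)
    (fun _ x _ => by simpa using h x)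
  simpa [symmetricMean] using this

open scoped ComplexOrder in
lemma absEigenvalues_sq (G : Matrix (Fin s) (Fin s) ℂ) (j : Fin s) :
    absEigenvalues G j ^ 2 = (isHermitian_mul_conjTranspose_self G).eigenvalues j :=
  Real.sq_sqrt ((posSemidef_self_mul_conjTranspose G).eigenvalues_nonneg j)

lemma symmetricMean_pow_even (k : ℕ) (G : Matrix (Fin s) (Fin s) ℂ) :
    symmetricMean (fun x => (x : ℂ) ^ (2 * k)) G = (s : ℂ)⁻¹ * (2 * ((G * Gᴴ) ^ k).trace) := by
  rw [symmetricMean, ← (isHermitian_mul_conjTranspose_self G).sum_eigenvalues_pow,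
    Finset.mul_sum _ _ (2 : ℂ)]
  congr 1
  refine Finset.sum_congr rfl fun j _ => ?_
  rw [← absEigenvalues_sq]
  push_cast
  rw [pow_mul, pow_mul, neg_sq, two_mul]

lemma symmetricMean_pow_odd (k : ℕ) (G : Matrix (Fin s) (Fin s) ℂ) :
    symmetricMean (fun x => (x : ℂ) ^ (2 * k + 1)) G = 0 := by
  rw [symmetricMean, Finset.sum_eq_zero, mul_zero]
  intro j _
  push_cast
  rw [Odd.neg_pow ⟨k, rfl⟩, add_neg_cancel]

lemma continuous_symmetricMean_pow (k : ℕ) :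
    Continuous (symmetricMean (s := s) fun x => (x : ℂ) ^ k) := by
  obtain ⟨l, rfl | rfl⟩ := Nat.even_or_odd' k
  · simp_rw [funext (symmetricMean_pow_even (s := s) l)]
    fun_prop
  · simp_rw [funext (symmetricMean_pow_odd (s := s) l)]
    exact continuous_const

lemma continuous_symmetricMean_eval (p : Polynomial ℂ) :
    Continuous (symmetricMean (s := s) fun x => p.eval (x : ℂ)) := by
  induction p using Polynomial.induction_on' with
  | add p q hp hq =>
    have : (symmetricMean (s := s) fun x => (p + q).eval (x : ℂ)) = fun G =>
        symmetricMean (fun x => p.eval (x : ℂ)) G + symmetricMean (fun x => q.eval (x : ℂ)) G := by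
      funext G
      rw [← symmetricMean_add]
      simp only [Polynomial.eval_add]
      rfl
    rw [this]
    exact hp.add hq
  | monomial k c =>
    simp only [Polynomial.eval_monomial]
    rw [funext (symmetricMean_const_mul (s := s) c _)]
    exact (continuous_symmetricMean_pow k).const_mul c

lemma absEigenvalues_le (G : Matrix (Fin s) (Fin s) ℂ) (j : Fin s) :
    absEigenvalues G j ≤ ∑ a, ∑ b, ‖(G * Gᴴ) a b‖ + 1 := by
  set N := ∑ a, ∑ b, ‖(G * Gᴴ) a b‖ with hN
  have hN0 : 0 ≤ N := by positivity
  have h := (isHermitian_mul_conjTranspose_self G).abs_eigenvalues_le (C := N)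
    (fun a => Finset.single_le_sum (f := fun a => ∑ b, ‖(G * Gᴴ) a b‖)
      (fun _ _ => by positivity) (Finset.mem_univ a)) j
  refine Real.sqrt_le_iff.2 ⟨by positivity, ?_⟩
  nlinarith [le_abs_self ((isHermitian_mul_conjTranspose_self G).eigenvalues j)]

lemma continuous_symmetricMean {φ : ℝ → ℂ} (hφ : Continuous φ) :
    Continuous (symmetricMean (s := s) φ) := by
  refine continuous_iff_continuousAt.2 fun G =>
    continuousAt_of_locally_uniform_approx_of_continuousAt fun u hu => ?_
  obtain ⟨ε, hε, hu⟩ := Metric.mem_uniformity_dist.1 hu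
  have hc : Continuous fun G : Matrix (Fin s) (Fin s) ℂ => ∑ a, ∑ b, ‖(G * Gᴴ) a b‖ := by
    fun_prop
  obtain ⟨p, hp⟩ := exists_polynomial_norm_sub_le hφ (∑ a, ∑ b, ‖(G * Gᴴ) a b‖ + 1 + 1)
    (ε := ε / 3) (by positivity)
  refine ⟨_, hc.continuousAt.eventually (gt_mem_nhds (lt_add_one _)), _,
    (continuous_symmetricMean_eval p).continuousAt, fun G' hG' => hu ?_⟩
  rw [dist_eq_norm]
  refine (norm_symmetricMean_sub_le (ε := ε / 3) (by positivity) fun j x hx => hp x ?_).trans_lt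
    (by linarith)
  have := absEigenvalues_le G' j
  have hG'' : ∑ a, ∑ b, ‖(G' * G'ᴴ) a b‖ < ∑ a, ∑ b, ‖(G * Gᴴ) a b‖ + 1 := hG'
  linarith

end SymmetricMean

section TrigonometricSymbol

variable {s : ℕ}

/-- The average of `φ` over the eigenvalues of a Hermitian `n × n` block matrix. -/
noncomputable def eigenvalueMean {n : ℕ} {H : Matrix (Fin n × Fin s) (Fin n × Fin s) ℂ}
    (hH : H.IsHermitian) (φ : ℝ → ℂ) : ℂ :=
  ((s * n : ℕ) : ℂ)⁻¹ * ∑ j, φ (hH.eigenvalues j)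

/-- The average of `φ` with respect to the eigenvalue symbol `ψ_{|g|}`. -/
noncomputable def symbolMean (g : ℝ → Matrix (Fin s) (Fin s) ℂ) (φ : ℝ → ℂ) : ℂ :=
  (1 / (4 * Real.pi) : ℂ) * ∫ θ in (-Real.pi)..Real.pi, symmetricMean φ (g θ)

lemma norm_eigenvalueMean_sub_le {n : ℕ} {H : Matrix (Fin n × Fin s) (Fin n × Fin s) ℂ}
    (hH : H.IsHermitian) {φ ψ : ℝ → ℂ} {ε : ℝ} (hε : 0 ≤ ε)
    (h : ∀ j, ‖φ (hH.eigenvalues j) - ψ (hH.eigenvalues j)‖ ≤ ε) :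
    ‖eigenvalueMean hH φ - eigenvalueMean hH ψ‖ ≤ ε := by
  rw [eigenvalueMean, eigenvalueMean, ← mul_sub, ← Finset.sum_sub_distrib, norm_mul, norm_inv,
    Complex.norm_natCast]
  have h1 : ‖∑ j, (φ (hH.eigenvalues j) - ψ (hH.eigenvalues j))‖ ≤ ∑ _j : Fin n × Fin s, ε :=
    norm_sum_le_of_le _ fun j _ => h j
  rw [Finset.sum_const, Finset.card_univ, Fintype.card_prod, Fintype.card_fin, Fintype.card_fin,
    nsmul_eq_mul, mul_comm n] at h1
  calc _ ≤ ((s * n : ℕ) : ℝ)⁻¹ * (((s * n : ℕ) : ℝ) * ε) := by gcongr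
    _ = (((s * n : ℕ) : ℝ)⁻¹ * ((s * n : ℕ) : ℝ)) * ε := by ring
    _ ≤ 1 * ε := by gcongr; exact inv_mul_le_one
    _ = _ := one_mul _

lemma norm_symbolMean_sub_le {g : ℝ → Matrix (Fin s) (Fin s) ℂ} {φ ψ : ℝ → ℂ} {ε : ℝ}
    (hφ : IntervalIntegrable (fun θ => symmetricMean φ (g θ)) volume (-Real.pi) Real.pi)
    (hψ : IntervalIntegrable (fun θ => symmetricMean ψ (g θ)) volume (-Real.pi) Real.pi)
    (h : ∀ θ ∈ Set.Ioc (-Real.pi) Real.pi,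
      ‖symmetricMean φ (g θ) - symmetricMean ψ (g θ)‖ ≤ 2 * ε) :
    ‖symbolMean g φ - symbolMean g ψ‖ ≤ ε := by
  have hpi := Real.pi_pos
  rw [symbolMean, symbolMean, ← mul_sub, ← intervalIntegral.integral_sub hφ hψ, norm_mul]
  have h1 := intervalIntegral.norm_integral_le_of_norm_le_const
    (a := -Real.pi) (b := Real.pi) (C := 2 * ε)
    (f := fun θ => symmetricMean φ (g θ) - symmetricMean ψ (g θ)) fun θ hθ =>
      h θ (by rwa [Set.uIoc_of_le (by linarith)] at hθ)
  rw [abs_of_nonneg (by linarith)] at h1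
  have h2 : ‖(1 / (4 * Real.pi) : ℂ)‖ = 1 / (4 * Real.pi) := by
    rw [norm_div, norm_mul, Complex.norm_real, Real.norm_of_nonneg hpi.le]
    simp
  rw [h2]
  calc _ ≤ 1 / (4 * Real.pi) * (2 * ε * (Real.pi - -Real.pi)) := by gcongr
    _ = ε := by field_simp; ring

lemma sum_norm_flippedToeplitz_le {n r : ℕ} {A : ℤ → Matrix (Fin s) (Fin s) ℂ}
    (hA : ∀ k, (r : ℤ) < |k| → A k = 0) (a : Fin n × Fin s) :
    ∑ b, ‖flippedToeplitz n A a b‖ ≤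
      ∑ m ∈ Finset.Icc (-(r : ℤ)) r, ∑ p, ∑ q, ‖A m p q‖ := by
  classical
  obtain ⟨j, p⟩ := a
  set ψ : ℤ → ℝ := fun m => ∑ p, ∑ q, ‖A m p q‖ with hψ
  have hψ0 : ∀ m, 0 ≤ ψ m := fun m => by positivity
  set I := (Finset.univ : Finset (Fin n)).image
    fun k : Fin n => (n : ℤ) - 1 - (j : ℕ) - (k : ℕ) with hI
  rw [Fintype.sum_prod_type]
  calc _ ≤ ∑ k : Fin n, ψ ((n : ℤ) - 1 - (j : ℕ) - (k : ℕ)) := Finset.sum_le_sum fun k _ =>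
        Finset.single_le_sum (f := fun p => ∑ q, ‖A ((n : ℤ) - 1 - (j : ℕ) - (k : ℕ)) p q‖)
          (fun _ _ => by positivity) (Finset.mem_univ p)
    _ = ∑ m ∈ I, ψ m := by
        rw [hI, Finset.sum_image]
        intro k _ l _ hkl
        exact Fin.ext (by simp only at hkl; omega)
    _ ≤ ∑ m ∈ I ∪ Finset.Icc (-(r : ℤ)) r, ψ m :=
        Finset.sum_le_sum_of_subset_of_nonneg Finset.subset_union_left fun m _ _ => hψ0 m
    _ = _ := (Finset.sum_subset Finset.subset_union_right fun m _ hm => by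
        rw [Finset.mem_Icc] at hm
        simp [hψ, hA m (by rw [lt_abs]; omega)]).symm

lemma tendsto_trace_pow_even {r : ℕ} {A : ℤ → Matrix (Fin s) (Fin s) ℂ}
    (hA : ∀ k, (r : ℤ) < |k| → A k = 0) (hherm : ∀ k, (A k).IsHermitian) (k : ℕ) :
    Tendsto (fun n : ℕ => (n : ℂ)⁻¹ * (flippedToeplitz n A ^ (2 * k)).trace) atTop
      (nhds ((1 / (2 * Real.pi) : ℂ) * ∫ θ in (-Real.pi)..Real.pi,
        ((trigSymbol A r θ * (trigSymbol A r θ)ᴴ) ^ k).trace)) := by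
  have hC : (0 : ℝ) ≤ ∑ m ∈ Finset.Icc (-(r : ℤ)) r, ∑ p, ∑ q, ‖A m p q‖ := by positivity
  have hg := continuous_trigSymbol A r
  have hL : (1 / (2 * Real.pi) : ℂ) * ∫ θ in (-Real.pi)..Real.pi,
        ((trigSymbol A r θ * (trigSymbol A r θ)ᴴ) ^ k).trace = ∑ p, (1 / (2 * Real.pi) : ℂ) *
      ∫ θ in (-Real.pi)..Real.pi, ((trigSymbol A r θ * trigSymbol A r (-θ)) ^ k) p p := by
    simp_rw [trigSymbol_neg hherm, trace, diag_apply]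
    rw [intervalIntegral.integral_finsetSum fun p _ =>
      (Continuous.intervalIntegrable (by fun_prop) _ _), Finset.mul_sum]
  rw [hL]
  refine (tendsto_inv_mul_sum_fin (B := s * (∑ m ∈ Finset.Icc (-(r : ℤ)) r,
    ∑ p, ∑ q, ‖A m p q‖) ^ (2 * k)) (K := 2 * k * r + 2 * k * r)
    (a := fun n j => ∑ p, (flippedToeplitz n A ^ (2 * k)) (j, p) (j, p)) ?_ ?_).congr fun n => ?_
  · intro n j
    refine (norm_sum_le_of_le _ fun p _ => norm_pow_apply_le hC
      (sum_norm_flippedToeplitz_le hA) (2 * k) _ _).trans_eq ?_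
    simp
  · intro n
    refine ⟨Finset.univ.filter fun j : Fin n => ¬ (2 * k * r ≤ (j : ℕ) ∧ (j : ℕ) + 2 * k * r < n),
      ?_, fun j hj => ?_⟩
    · refine (Finset.card_le_card_of_injOn (t := Finset.range (2 * k * r) ∪
        Finset.Ico (n - 2 * k * r) n) (fun j : Fin n => (j : ℕ)) ?_ ?_).trans ?_
      · intro j hj
        simp only [Finset.coe_filter, Finset.mem_univ, true_and, Set.mem_ofPred_eq] at hj
        have := j.2
        simp only [Finset.coe_union, Finset.coe_range, Finset.coe_Ico, Set.mem_union, Set.mem_Iio,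
          Set.mem_Ico]
        omega
      · exact Fin.val_injective.injOn
      · refine (Finset.card_union_le _ _).trans ?_
        rw [Finset.card_range, Nat.card_Ico]
        omega
    · simp only [Finset.mem_filter, Finset.mem_univ, true_and, not_not] at hj
      exact Finset.sum_congr rfl fun p _ => flippedToeplitz_pow_diag hA k j hj.1 hj.2 p
  · rw [trace, Fintype.sum_prod_type]
    rfl

lemma tendsto_trace_pow_odd {r : ℕ} {A : ℤ → Matrix (Fin s) (Fin s) ℂ}
    (hA : ∀ k, (r : ℤ) < |k| → A k = 0) (k : ℕ) :
    Tendsto (fun n : ℕ => (n : ℂ)⁻¹ * (flippedToeplitz n A ^ (2 * k + 1)).trace) atTop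
      (nhds 0) := by
  have hC : (0 : ℝ) ≤ ∑ m ∈ Finset.Icc (-(r : ℤ)) r, ∑ p, ∑ q, ‖A m p q‖ := by positivity
  refine (tendsto_inv_mul_sum_fin (B := s * (∑ m ∈ Finset.Icc (-(r : ℤ)) r,
    ∑ p, ∑ q, ‖A m p q‖) ^ (2 * k + 1)) (K := 2 * ((2 * k + 1) * r) + 1)
    (a := fun n j => ∑ p, (flippedToeplitz n A ^ (2 * k + 1)) (j, p) (j, p)) ?_ ?_).congr
    fun n => ?_
  · intro n j
    refine (norm_sum_le_of_le _ fun p _ => norm_pow_apply_le hC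
      (sum_norm_flippedToeplitz_le hA) (2 * k + 1) _ _).trans_eq ?_
    simp
  · intro n
    refine ⟨Finset.univ.filter fun j : Fin n =>
      ¬ (((2 * k + 1) * r : ℕ) < |(n : ℤ) - 1 - (j : ℕ) - (j : ℕ)|), ?_, fun j hj => ?_⟩
    · generalize (2 * k + 1) * r = R
      refine (Finset.card_le_card_of_injOn (t := Finset.Icc (-(R : ℤ)) R)
        (fun j : Fin n => (n : ℤ) - 1 - (j : ℕ) - (j : ℕ)) ?_ ?_).trans ?_
      · intro j hj
        simp only [Finset.coe_filter, Finset.mem_univ, true_and, Set.mem_ofPred_eq, not_lt] at hj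
        simp only [Finset.coe_Icc, Set.mem_Icc]
        exact abs_le.1 hj
      · intro j _ l _ hjl
        exact Fin.ext (by simp only at hjl; omega)
      · rw [Int.card_Icc]
        omega
    · simp only [Finset.mem_filter, Finset.mem_univ, true_and, not_not] at hj
      exact Finset.sum_eq_zero fun p _ => (flippedToeplitz_pow_eq_zero hA k j j p p).2 hj
  · rw [trace, Fintype.sum_prod_type]
    rfl

lemma tendsto_eigenvalueMean_pow {r : ℕ} {A : ℤ → Matrix (Fin s) (Fin s) ℂ}
    (hA : ∀ k, (r : ℤ) < |k| → A k = 0) (hherm : ∀ k, (A k).IsHermitian) (k : ℕ) :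
    Tendsto (fun n : ℕ => eigenvalueMean (flippedToeplitz_isHermitian n hherm)
      fun x => (x : ℂ) ^ k) atTop
      (nhds (symbolMean (trigSymbol A r) fun x => (x : ℂ) ^ k)) := by
  have e : ∀ n, eigenvalueMean (flippedToeplitz_isHermitian n hherm) (fun x => (x : ℂ) ^ k) =
      (s : ℂ)⁻¹ * ((n : ℂ)⁻¹ * (flippedToeplitz n A ^ k).trace) := by
    intro n
    rw [eigenvalueMean, Matrix.IsHermitian.sum_eigenvalues_pow, Nat.cast_mul, mul_inv, mul_assoc]
  simp_rw [e]
  obtain ⟨l, rfl | rfl⟩ := Nat.even_or_odd' k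
  · convert (tendsto_trace_pow_even hA hherm l).const_mul ((s : ℂ)⁻¹) using 2
    rw [symbolMean]
    simp_rw [symmetricMean_pow_even, intervalIntegral.integral_const_mul]
    ring
  · convert (tendsto_trace_pow_odd hA l).const_mul ((s : ℂ)⁻¹) using 2
    rw [symbolMean]
    simp_rw [symmetricMean_pow_odd]
    simp

lemma tendsto_eigenvalueMean_eval {r : ℕ} {A : ℤ → Matrix (Fin s) (Fin s) ℂ}
    (hA : ∀ k, (r : ℤ) < |k| → A k = 0) (hherm : ∀ k, (A k).IsHermitian) (p : Polynomial ℂ) :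
    Tendsto (fun n : ℕ => eigenvalueMean (flippedToeplitz_isHermitian n hherm)
      fun x => p.eval (x : ℂ)) atTop
      (nhds (symbolMean (trigSymbol A r) fun x => p.eval (x : ℂ))) := by
  have hint : ∀ q : Polynomial ℂ, IntervalIntegrable (fun θ =>
      symmetricMean (fun x => q.eval (x : ℂ)) (trigSymbol A r θ)) volume (-Real.pi) Real.pi :=
    fun q => ((continuous_symmetricMean_eval q).comp
      (continuous_trigSymbol A r)).intervalIntegrable _ _
  induction p using Polynomial.induction_on' with
  | add p q hp hq =>
    convert hp.add hq using 1
    · funext n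
      simp only [eigenvalueMean, ← mul_add, ← Finset.sum_add_distrib, Polynomial.eval_add]
    · rw [symbolMean, symbolMean, symbolMean, ← mul_add,
        ← intervalIntegral.integral_add (hint p) (hint q)]
      simp_rw [← symmetricMean_add, Polynomial.eval_add]
      rfl
  | monomial k c =>
    convert (tendsto_eigenvalueMean_pow hA hherm k).const_mul c using 1
    · funext n
      simp only [eigenvalueMean, Polynomial.eval_monomial, ← Finset.mul_sum]
      ring
    · simp_rw [symbolMean, Polynomial.eval_monomial, symmetricMean_const_mul,
        intervalIntegral.integral_const_mul]
      congr 1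
      ring

lemma tendsto_eigenvalueMean_trigSymbol {r : ℕ} {A : ℤ → Matrix (Fin s) (Fin s) ℂ}
    (hA : ∀ k, (r : ℤ) < |k| → A k = 0) (hherm : ∀ k, (A k).IsHermitian) {φ : ℝ → ℂ}
    (hφ : Continuous φ) :
    Tendsto (fun n : ℕ => eigenvalueMean (flippedToeplitz_isHermitian n hherm) φ) atTop
      (nhds (symbolMean (trigSymbol A r) φ)) := by
  have hg := continuous_trigSymbol A r
  obtain ⟨D, hD⟩ := (isCompact_Icc (a := -Real.pi) (b := Real.pi)).exists_bound_of_continuousOn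
    (f := fun θ => ∑ a, ∑ b, ‖(trigSymbol A r θ * (trigSymbol A r θ)ᴴ) a b‖ + 1)
    (Continuous.continuousOn (by fun_prop))
  refine tendsto_of_forall_exists_near fun ε hε => ?_
  obtain ⟨p, hp⟩ := exists_polynomial_norm_sub_le hφ
    (max (∑ m ∈ Finset.Icc (-(r : ℤ)) r, ∑ p, ∑ q, ‖A m p q‖) D) hε
  refine ⟨_, _, tendsto_eigenvalueMean_eval hA hherm p, fun n => ?_, ?_⟩
  · exact norm_eigenvalueMean_sub_le _ hε.le fun j => hp _ <| le_max_of_le_left <|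
      Matrix.IsHermitian.abs_eigenvalues_le _ (sum_norm_flippedToeplitz_le hA) j
  · refine norm_symbolMean_sub_le (((continuous_symmetricMean hφ).comp hg).intervalIntegrable _ _)
      (((continuous_symmetricMean_eval p).comp hg).intervalIntegrable _ _) fun θ hθ =>
      norm_symmetricMean_sub_le hε.le fun j x hx => hp _ <| le_max_of_le_right ?_
    exact (hx.trans (absEigenvalues_le _ j)).trans
      ((Real.le_norm_self _).trans (hD θ (Set.Ioc_subset_Icc_self hθ)))

end TrigonometricSymbol

section Approximation

variable {s : ℕ}

lemma IntervalIntegrable.star_comp_neg {u : ℝ → ℂ} {a : ℝ}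
    (hu : IntervalIntegrable u volume (-a) a) :
    IntervalIntegrable (fun θ => star (u (-θ))) volume (-a) a := by
  have h : IntervalIntegrable (fun θ => u (-θ)) volume (-a) a := by
    have := (IntervalIntegrable.iff_comp_neg (by simp)).1 hu
    rw [neg_neg] at this
    exact this.symm
  exact ⟨Complex.conjCLE.toContinuousLinearMap.integrable_comp h.1,
    Complex.conjCLE.toContinuousLinearMap.integrable_comp h.2⟩

lemma ae_eq_star_comp_neg {f : ℝ → Matrix (Fin s) (Fin s) ℂ}
    (hf : ∀ p q, IntervalIntegrable (fun θ => f θ p q) volume (-Real.pi) Real.pi)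
    (hherm : ∀ k, (blockFourierCoeff f k).IsHermitian) (p q : Fin s) :
    ∀ᵐ θ ∂volume.restrict (Set.Ioc (-Real.pi) Real.pi), f θ p q = star (f (-θ) q p) := by
  have hpi := Real.pi_pos
  have hd := (hf p q).sub (hf q p).star_comp_neg
  have h0 := ae_eq_zero_of_integral_mul_exp
    ((intervalIntegrable_iff_integrableOn_Ioc_of_le (by linarith)).1 hd) fun k => by
      have hexp : ∀ g : ℝ → ℂ, IntervalIntegrable g volume (-Real.pi) Real.pi →
          IntervalIntegrable (fun θ : ℝ => g θ * Complex.exp (-Complex.I * k * θ)) volume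
            (-Real.pi) Real.pi :=
        fun g hg => hg.mul_continuousOn (Continuous.continuousOn (by fun_prop))
      have e : ∀ θ : ℝ, star (f (-θ) q p) * Complex.exp (-Complex.I * k * θ) =
          (fun x : ℝ => star (f x q p * Complex.exp (-Complex.I * k * x))) (-θ) := by
        intro θ
        simp only [star_mul', Complex.star_def, ← Complex.exp_conj]
        simp
      have hstar : ∫ θ in (-Real.pi)..Real.pi,
          star (f θ q p * Complex.exp (-Complex.I * k * θ)) =
          star (∫ θ in (-Real.pi)..Real.pi, f θ q p * Complex.exp (-Complex.I * k * θ)) := by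
        rw [intervalIntegral.integral_of_le (by linarith),
          intervalIntegral.integral_of_le (by linarith)]
        exact integral_conj
      have hA := (hherm k).apply p q
      simp only [blockFourierCoeff, of_apply, star_mul'] at hA
      have hreal : star (1 / (2 * Real.pi) : ℂ) = 1 / (2 * Real.pi) := by
        simp
      rw [hreal] at hA
      have hc : (1 / (2 * Real.pi) : ℂ) ≠ 0 := by
        have : (Real.pi : ℂ) ≠ 0 := by exact_mod_cast hpi.ne'
        simp [this]
      simp only [sub_mul]
      rw [intervalIntegral.integral_sub (hexp _ (hf p q)) (hexp _ (hf q p).star_comp_neg)]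
      simp_rw [e]
      rw [intervalIntegral.integral_comp_neg
        (fun x : ℝ => star (f x q p * Complex.exp (-Complex.I * k * x))), neg_neg, hstar,
        mul_left_cancel₀ hc hA, sub_self]
  filter_upwards [h0] with θ hθ
  exact sub_eq_zero.1 hθ

lemma trigSymbol_apply {A : ℤ → Matrix (Fin s) (Fin s) ℂ} {r : ℕ} (θ : ℝ) (p q : Fin s) :
    trigSymbol A r θ p q =
      ∑ k ∈ Finset.Icc (-(r : ℤ)) r, Complex.exp (Complex.I * k * θ) * A k p q := by
  simp only [trigSymbol, Matrix.sum_apply, Matrix.smul_apply, smul_eq_mul]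

lemma blockFourierCoeff_trigSymbol {A : ℤ → Matrix (Fin s) (Fin s) ℂ} {r : ℕ}
    (hA : ∀ k, (r : ℤ) < |k| → A k = 0) : blockFourierCoeff (trigSymbol A r) = A := by
  have hpi : (Real.pi : ℂ) ≠ 0 := by exact_mod_cast Real.pi_ne_zero
  funext k
  ext p q
  rw [blockFourierCoeff, of_apply]
  have e : ∀ θ : ℝ, trigSymbol A r θ p q * Complex.exp (-Complex.I * k * θ) =
      ∑ m ∈ Finset.Icc (-(r : ℤ)) r,
        A m p q * Complex.exp (Complex.I * (m - k : ℤ) * θ) := by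
    intro θ
    rw [trigSymbol_apply, Finset.sum_mul]
    refine Finset.sum_congr rfl fun m _ => ?_
    rw [mul_right_comm, ← Complex.exp_add, mul_comm]
    congr 2
    push_cast
    ring
  simp_rw [e]
  rw [intervalIntegral.integral_finsetSum fun m _ =>
    (Continuous.intervalIntegrable (by fun_prop) _ _)]
  simp_rw [intervalIntegral.integral_const_mul, integral_exp_int_mul]
  by_cases hk : k ∈ Finset.Icc (-(r : ℤ)) r
  · rw [Finset.sum_eq_single_of_mem k hk fun m _ hm => by
      rw [if_neg (sub_ne_zero.2 hm), mul_zero], if_pos (sub_self k)]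
    field_simp
  · rw [Finset.sum_eq_zero fun m hm => by
      rw [if_neg (sub_ne_zero.2 fun h : m = k => hk (h ▸ hm)), mul_zero]]
    rw [Finset.mem_Icc] at hk
    rw [hA k (by rw [lt_abs]; omega)]
    simp

lemma blockFourierCoeff_sub {f g : ℝ → Matrix (Fin s) (Fin s) ℂ}
    (hf : ∀ p q, IntervalIntegrable (fun θ => f θ p q) volume (-Real.pi) Real.pi)
    (hg : ∀ p q, IntervalIntegrable (fun θ => g θ p q) volume (-Real.pi) Real.pi) :
    blockFourierCoeff (f - g) = blockFourierCoeff f - blockFourierCoeff g := by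
  funext k
  ext p q
  have hexp : ∀ u : ℝ → ℂ, IntervalIntegrable u volume (-Real.pi) Real.pi →
      IntervalIntegrable (fun θ : ℝ => u θ * Complex.exp (-Complex.I * k * θ)) volume
        (-Real.pi) Real.pi :=
    fun u hu => hu.mul_continuousOn (Continuous.continuousOn (by fun_prop))
  simp only [blockFourierCoeff, of_apply, Pi.sub_apply, Matrix.sub_apply, sub_mul]
  rw [intervalIntegral.integral_sub (hexp _ (hf p q)) (hexp _ (hg p q)), mul_sub]

lemma exists_trigSymbol_integral_le {f : ℝ → Matrix (Fin s) (Fin s) ℂ}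
    (hf : ∀ p q, IntervalIntegrable (fun θ => f θ p q) volume (-Real.pi) Real.pi)
    (hherm : ∀ k, (blockFourierCoeff f k).IsHermitian) {ε : ℝ} (hε : 0 < ε) :
    ∃ (r : ℕ) (B : ℤ → Matrix (Fin s) (Fin s) ℂ), (∀ k, (r : ℤ) < |k| → B k = 0) ∧
      (∀ k, (B k).IsHermitian) ∧
      ∑ p, ∑ q, ∫ θ in (-Real.pi)..Real.pi, ‖f θ p q - trigSymbol B r θ p q‖ ≤ ε := by
  have hpi := Real.pi_pos
  have hδ : 0 < ε / (s * s + 1) := by positivity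
  choose c hc using fun p q => exists_trigPoly_integral_le
    ((intervalIntegrable_iff_integrableOn_Ioc_of_le (by linarith)).1 (hf p q)) hδ
  let r : ℕ := Finset.univ.sup fun p => Finset.univ.sup fun q => (c p q).support.sup Int.natAbs
  have hr : ∀ p q k, (r : ℤ) < |k| → c p q k = 0 := by
    intro p q k hk
    by_contra h
    have h1 : k.natAbs ≤ (c p q).support.sup Int.natAbs :=
      Finset.le_sup (f := Int.natAbs) (Finsupp.mem_support_iff.2 h)
    have h2 : (c p q).support.sup Int.natAbs ≤
        Finset.univ.sup fun q => (c p q).support.sup Int.natAbs :=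
      Finset.le_sup (f := fun q => (c p q).support.sup Int.natAbs) (Finset.mem_univ q)
    have h3 : (Finset.univ.sup fun q => (c p q).support.sup Int.natAbs) ≤ r :=
      Finset.le_sup (f := fun p => Finset.univ.sup fun q => (c p q).support.sup Int.natAbs)
        (Finset.mem_univ p)
    have : ((k.natAbs : ℕ) : ℤ) ≤ r := by exact_mod_cast h1.trans (h2.trans h3)
    rw [Int.natCast_natAbs] at this
    omega
  let B : ℤ → Matrix (Fin s) (Fin s) ℂ := fun k => of fun p q =>
    (2⁻¹ : ℂ) * (c p q k + star (c q p k))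
  have hpoly : ∀ p q θ, trigPoly (c p q) θ =
      ∑ k ∈ Finset.Icc (-(r : ℤ)) r, Complex.exp (Complex.I * k * θ) * c p q k := by
    intro p q θ
    rw [trigPoly]
    refine (Finset.sum_subset (fun k hk => ?_) fun k _ hk => ?_).trans
      (Finset.sum_congr rfl fun k _ => mul_comm _ _)
    · by_contra h
      rw [Finset.mem_Icc] at h
      exact Finsupp.mem_support_iff.1 hk (hr p q k (by rw [lt_abs]; omega))
    · rw [Finsupp.notMem_support_iff.1 hk, zero_mul]
  have hB : ∀ p q (θ : ℝ), trigSymbol B r θ p q =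
      2⁻¹ * (trigPoly (c p q) θ + star (trigPoly (c q p) (-θ))) := by
    intro p q θ
    rw [trigSymbol_apply, hpoly, hpoly, star_sum, ← Finset.sum_add_distrib, Finset.mul_sum]
    refine Finset.sum_congr rfl fun k _ => ?_
    rw [star_mul', Complex.star_def, ← Complex.exp_conj]
    have : (starRingEnd ℂ) (Complex.I * k * ((-θ : ℝ) : ℂ)) = Complex.I * k * θ := by simp
    rw [this]
    simp only [B, of_apply, Complex.star_def]
    ring
  refine ⟨r, B, fun k hk => ?_, fun k => ?_, ?_⟩
  · ext p q
    simp [B, hr _ _ _ hk]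
  · ext p q
    simp only [B, conjTranspose_apply, of_apply, star_mul', star_add, star_star, add_comm]
    simp
  · have hu : ∀ p q, IntervalIntegrable (fun θ => f θ p q - trigPoly (c p q) θ) volume
        (-Real.pi) Real.pi := fun p q => (hf p q).sub
      (Continuous.intervalIntegrable (by unfold trigPoly; fun_prop) _ _)
    have key : ∀ p q, ∫ θ in (-Real.pi)..Real.pi, ‖f θ p q - trigSymbol B r θ p q‖ ≤
        ε / (s * s + 1) := by
      intro p q
      calc _ = ∫ θ in (-Real.pi)..Real.pi, ‖2⁻¹ * ((f θ p q - trigPoly (c p q) θ) +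
              star (f (-θ) q p - trigPoly (c q p) (-θ)))‖ := by
            refine intervalIntegral.integral_congr_ae ?_
            rw [← ae_restrict_iff' measurableSet_uIoc, Set.uIoc_of_le (by linarith)]
            filter_upwards [ae_eq_star_comp_neg hf hherm p q] with θ hθ
            rw [hB, star_sub, ← hθ]
            congr 1
            ring
        _ ≤ ∫ θ in (-Real.pi)..Real.pi, 2⁻¹ * (‖f θ p q - trigPoly (c p q) θ‖ +
              ‖star (f (-θ) q p - trigPoly (c q p) (-θ))‖) := by
            refine intervalIntegral.integral_mono (by linarith)
              (((hu p q).add (hu q p).star_comp_neg).const_mul _).norm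
              (((hu p q).norm.add (hu q p).star_comp_neg.norm).const_mul _) fun θ => ?_
            simp only [norm_mul, norm_inv, Complex.norm_ofNat]
            gcongr
            exact norm_add_le _ _
        _ = 2⁻¹ * ((∫ θ in (-Real.pi)..Real.pi, ‖f θ p q - trigPoly (c p q) θ‖) +
              ∫ θ in (-Real.pi)..Real.pi, ‖f θ q p - trigPoly (c q p) θ‖) := by
            rw [intervalIntegral.integral_const_mul, intervalIntegral.integral_add (hu p q).norm
              (hu q p).star_comp_neg.norm]
            simp only [norm_star]
            rw [intervalIntegral.integral_comp_neg
              (fun θ => ‖f θ q p - trigPoly (c q p) θ‖), neg_neg]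
        _ ≤ 2⁻¹ * (ε / (s * s + 1) + ε / (s * s + 1)) := by
            gcongr
            exacts [hc p q, hc q p]
        _ = _ := by ring
    calc _ ≤ ∑ _p : Fin s, ∑ _q : Fin s, ε / (s * s + 1) :=
          Finset.sum_le_sum fun p _ => Finset.sum_le_sum fun q _ => key p q
      _ = (s * s) / (s * s + 1) * ε := by
          simp only [Finset.sum_const, Finset.card_univ, Fintype.card_fin, nsmul_eq_mul]
          ring
      _ ≤ 1 * ε := by
          gcongr
          rw [div_le_one (by positivity)]
          linarith
      _ = ε := one_mul ε

end Approximation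

section Limit

variable {s : ℕ}

lemma aestronglyMeasurable_of_entries {f : ℝ → Matrix (Fin s) (Fin s) ℂ} {μ : Measure ℝ}
    (hf : ∀ p q, AEStronglyMeasurable (fun θ => f θ p q) μ) : AEStronglyMeasurable f μ := by
  have e : f = fun θ => ∑ p, ∑ q, f θ p q • Matrix.single p q (1 : ℂ) := by
    funext θ
    conv_lhs => rw [matrix_eq_sum_single (f θ)]
    simp
  rw [e]
  exact Finset.aestronglyMeasurable_fun_sum _ fun p _ =>
    Finset.aestronglyMeasurable_fun_sum _ fun q _ => (hf p q).smul_const _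

lemma intervalIntegrable_symmetricMean {f : ℝ → Matrix (Fin s) (Fin s) ℂ}
    (hf : ∀ p q, IntervalIntegrable (fun θ => f θ p q) volume (-Real.pi) Real.pi) {φ : ℝ → ℂ}
    (hφ : Continuous φ) {b : ℝ} (hb : 0 ≤ b) (hφb : ∀ x, ‖φ x‖ ≤ b) :
    IntervalIntegrable (fun θ => symmetricMean φ (f θ)) volume (-Real.pi) Real.pi := by
  have hpi := Real.pi_pos
  refine (intervalIntegrable_const (c := 2 * b)).mono_fun ?_ (ae_of_all _ fun θ => ?_)
  · refine (continuous_symmetricMean hφ).comp_aestronglyMeasurable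
      (aestronglyMeasurable_of_entries fun p q => ?_)
    rw [Set.uIoc_of_le (by linarith)]
    exact (hf p q).aestronglyMeasurable
  · rw [Real.norm_of_nonneg (by positivity)]
    exact norm_symmetricMean_le hb hφb _

lemma exists_trigSymbol_symbolMean_near {f : ℝ → Matrix (Fin s) (Fin s) ℂ}
    (hf : ∀ p q, IntervalIntegrable (fun θ => f θ p q) volume (-Real.pi) Real.pi)
    (hherm : ∀ k, (blockFourierCoeff f k).IsHermitian) {φ : ℝ → ℂ} (hφ : Continuous φ) {b : ℝ}
    (hb : 0 ≤ b) (hφb : ∀ x, ‖φ x‖ ≤ b) {ε : ℝ} (hε : 0 < ε) :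
    ∃ (r : ℕ) (B : ℤ → Matrix (Fin s) (Fin s) ℂ), (∀ k, (r : ℤ) < |k| → B k = 0) ∧
      (∀ k, (B k).IsHermitian) ∧
      ∑ p, ∑ q, ∫ θ in (-Real.pi)..Real.pi, ‖f θ p q - trigSymbol B r θ p q‖ ≤ ε ∧
      ‖symbolMean f φ - symbolMean (trigSymbol B r) φ‖ ≤ ε := by
  have hpi := Real.pi_pos
  choose r B hB hBherm hint using fun m : ℕ => exists_trigSymbol_integral_le hf hherm
    (ε := 1 / ((m : ℝ) + 1)) (by positivity)
  let μ := volume.restrict (Set.Ioc (-Real.pi) Real.pi)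
  let u : ℕ → ℝ → ℝ := fun m θ => ∑ p, ∑ q, ‖f θ p q - trigSymbol (B m) (r m) θ p q‖
  have hg : ∀ m p q, IntervalIntegrable (fun θ => trigSymbol (B m) (r m) θ p q) volume
      (-Real.pi) Real.pi := fun m p q => by
    have := continuous_trigSymbol (B m) (r m)
    exact Continuous.intervalIntegrable (by fun_prop) _ _
  have hu1 : ∀ m p q, IntervalIntegrable
      (fun θ => ‖f θ p q - trigSymbol (B m) (r m) θ p q‖) volume (-Real.pi) Real.pi :=
    fun m p q => ((hf p q).sub (hg m p q)).norm
  have hu : ∀ m, Integrable (u m) μ := fun m =>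
    integrable_finsetSum _ fun p _ => integrable_finsetSum _ fun q _ => (hu1 m p q).1
  have hu0 : ∀ m θ, 0 ≤ u m θ := fun m θ => by positivity
  have huint : ∀ m, ∫ θ, u m θ ∂μ ≤ 1 / ((m : ℝ) + 1) := by
    intro m
    refine le_of_eq_of_le ?_ (hint m)
    rw [integral_finsetSum _ fun p _ => integrable_finsetSum _ fun q _ => (hu1 m p q).1]
    refine Finset.sum_congr rfl fun p _ => ?_
    rw [integral_finsetSum _ fun q _ => (hu1 m p q).1]
    refine Finset.sum_congr rfl fun q _ => ?_
    rw [intervalIntegral.integral_of_le (by linarith)]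
  have hmeas : TendstoInMeasure μ u atTop fun _ => 0 := by
    refine tendstoInMeasure_of_tendsto_eLpNorm (p := 1) one_ne_zero (fun m => (hu m).1)
      aestronglyMeasurable_const ?_
    have e : ∀ m, eLpNorm (u m - fun _ => 0) 1 μ = ENNReal.ofReal (∫ θ, u m θ ∂μ) := by
      intro m
      rw [eLpNorm_one_eq_lintegral_enorm]
      simp only [Pi.sub_apply, sub_zero]
      rw [← ofReal_integral_norm_eq_lintegral_enorm (hu m)]
      simp only [Real.norm_of_nonneg (hu0 m _)]
    simp_rw [e]
    rw [← ENNReal.ofReal_zero]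
    exact ENNReal.tendsto_ofReal (squeeze_zero (fun m => integral_nonneg (hu0 m)) huint
      tendsto_one_div_add_atTop_nhds_zero_nat)
  obtain ⟨ns, hns, hae⟩ := hmeas.exists_seq_tendsto_ae
  have hlim : Tendsto (fun i => symbolMean (trigSymbol (B (ns i)) (r (ns i))) φ) atTop
      (nhds (symbolMean f φ)) := by
    refine Tendsto.const_mul _
      (intervalIntegral.tendsto_integral_filter_of_dominated_convergence (fun _ => 2 * b) ?_ ?_
        intervalIntegrable_const ?_)
    · exact Eventually.of_forall fun i => ((continuous_symmetricMean hφ).comp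
        (continuous_trigSymbol _ _)).aestronglyMeasurable
    · exact Eventually.of_forall fun i => ae_of_all _ fun θ _ => norm_symmetricMean_le hb hφb _
    · rw [← ae_restrict_iff' measurableSet_uIoc, Set.uIoc_of_le (by linarith)]
      filter_upwards [hae] with θ hθ
      refine ((continuous_symmetricMean hφ).tendsto _).comp
        (tendsto_pi_nhds.2 fun p => tendsto_pi_nhds.2 fun q => ?_)
      rw [tendsto_iff_norm_sub_tendsto_zero]
      refine squeeze_zero (fun _ => norm_nonneg _) (fun i => ?_) hθ
      rw [norm_sub_rev]
      exact (Finset.single_le_sum (f := fun q =>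
          ‖f θ p q - trigSymbol (B (ns i)) (r (ns i)) θ p q‖)
          (fun _ _ => norm_nonneg _) (Finset.mem_univ q)).trans
        (Finset.single_le_sum (f := fun p => ∑ q,
          ‖f θ p q - trigSymbol (B (ns i)) (r (ns i)) θ p q‖)
          (fun _ _ => by positivity) (Finset.mem_univ p))
  have hsmall : ∀ᶠ i in atTop, 1 / (((ns i : ℕ) : ℝ) + 1) < ε :=
    (tendsto_one_div_add_atTop_nhds_zero_nat.comp hns.tendsto_atTop).eventually (gt_mem_nhds hε)
  obtain ⟨i, hi, hi'⟩ := (hsmall.and (hlim.eventually (Metric.ball_mem_nhds _ hε))).exists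
  refine ⟨r (ns i), B (ns i), hB _, hBherm _, (hint _).trans hi.le, ?_⟩
  rw [← dist_eq_norm, dist_comm]
  exact hi'.le

open scoped Matrix.Norms.L2Operator in
lemma TraceLipschitz.norm_eigenvalueMean_sub_le {φ : ℝ → ℂ} {C : ℝ} (hC : 0 ≤ C)
    (hφ : ∀ (m : Type) [Fintype m] [DecidableEq m] (H K : Matrix m m ℂ) (hH : H.IsHermitian)
      (hK : K.IsHermitian) (τ : ℝ), (∀ M : Matrix m m ℂ, ‖(M * (H - K)).trace‖ ≤ τ * ‖M‖) →
      ∀ M : Matrix m m ℂ, ‖(M * (hH.funCalc φ - hK.funCalc φ)).trace‖ ≤ C * τ * ‖M‖)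
    {n : ℕ} {H K : Matrix (Fin n × Fin s) (Fin n × Fin s) ℂ} (hH : H.IsHermitian)
    (hK : K.IsHermitian) {δ : ℝ} (hδ : 0 ≤ δ)
    (h : ∀ M : Matrix (Fin n × Fin s) (Fin n × Fin s) ℂ,
      ‖(M * (H - K)).trace‖ ≤ n * δ * ‖M‖) :
    ‖eigenvalueMean hH φ - eigenvalueMean hK φ‖ ≤ C * δ := by
  rcases Nat.eq_zero_or_pos s with rfl | hs
  · simp only [eigenvalueMean, zero_mul, Nat.cast_zero, _root_.inv_zero, sub_self, norm_zero]
    positivity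
  have h1 := hφ _ H K hH hK _ h 1
  rw [one_mul, trace_sub, Matrix.IsHermitian.trace_funCalc,
    Matrix.IsHermitian.trace_funCalc] at h1
  have hone : ‖(1 : Matrix (Fin n × Fin s) (Fin n × Fin s) ℂ)‖ ≤ 1 := by
    rw [← diagonal_one, l2_opNorm_diagonal]
    exact (pi_norm_le_iff_of_nonneg zero_le_one).2 fun _ => by simp
  rw [eigenvalueMean, eigenvalueMean, ← mul_sub, norm_mul, norm_inv, Complex.norm_natCast]
  have hs' : ((s : ℝ))⁻¹ ≤ 1 := inv_le_one_of_one_le₀ (by exact_mod_cast hs)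
  calc _ ≤ ((s * n : ℕ) : ℝ)⁻¹ * (C * (n * δ) * 1) := by
        gcongr
        exact h1.trans (by gcongr)
    _ = ((s : ℝ))⁻¹ * (((n : ℝ))⁻¹ * n) * (C * δ) := by
        push_cast
        rw [mul_inv]
        ring
    _ ≤ 1 * 1 * (C * δ) := by
        gcongr
        exact inv_mul_le_one
    _ = _ := by ring

open scoped Matrix.Norms.L2Operator in
lemma tendsto_eigenvalueMean_of_traceLipschitz {f : ℝ → Matrix (Fin s) (Fin s) ℂ}
    (hf : ∀ p q, IntervalIntegrable (fun θ => f θ p q) volume (-Real.pi) Real.pi)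
    (hherm : ∀ k, (blockFourierCoeff f k).IsHermitian) {φ : ℝ → ℂ} (hφ : TraceLipschitz φ) :
    Tendsto (fun n : ℕ => eigenvalueMean (flippedToeplitz_isHermitian n hherm) φ) atTop
      (nhds (symbolMean f φ)) := by
  obtain ⟨b, hb, hφb⟩ := hφ.bounded
  obtain ⟨C, hC, hlip⟩ := hφ.lipschitz
  refine tendsto_of_forall_exists_near fun ε hε => ?_
  obtain ⟨r, B, hB, hBherm, hint, hmean⟩ := exists_trigSymbol_symbolMean_near hf hherm
    hφ.continuous hb hφb (ε := ε / (C + 1)) (by positivity)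
  have hg : ∀ p q, IntervalIntegrable (fun θ => trigSymbol B r θ p q) volume
      (-Real.pi) Real.pi := fun p q => by
    have := continuous_trigSymbol B r
    exact Continuous.intervalIntegrable (by fun_prop) _ _
  refine ⟨_, _, tendsto_eigenvalueMean_trigSymbol hB hBherm hφ.continuous, fun n => ?_,
    hmean.trans (div_le_self hε.le (by linarith))⟩
  have hsub : flippedToeplitz n (blockFourierCoeff f) - flippedToeplitz n B =
      flippedToeplitz n (blockFourierCoeff (f - trigSymbol B r)) := by
    rw [blockFourierCoeff_sub hf hg, blockFourierCoeff_trigSymbol hB, flippedToeplitz_sub]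
  refine (TraceLipschitz.norm_eigenvalueMean_sub_le hC hlip _ _ (δ := ε / (C + 1))
    (by positivity) fun M => ?_).trans ?_
  · rw [hsub]
    refine (norm_trace_mul_flippedToeplitz_le n (fun p q => (hf p q).sub (hg p q)) M).trans ?_
    gcongr
  · rw [mul_div_assoc', div_le_iff₀ (by positivity)]
    nlinarith

lemma tendsto_eigenvalueMean {f : ℝ → Matrix (Fin s) (Fin s) ℂ}
    (hf : ∀ p q, IntervalIntegrable (fun θ => f θ p q) volume (-Real.pi) Real.pi)
    (hherm : ∀ k, (blockFourierCoeff f k).IsHermitian) {φ : ℝ → ℂ} (hφ : Continuous φ)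
    (hc : HasCompactSupport φ) :
    Tendsto (fun n : ℕ => eigenvalueMean (flippedToeplitz_isHermitian n hherm) φ) atTop
      (nhds (symbolMean f φ)) := by
  refine tendsto_of_forall_exists_near fun ε hε => ?_
  obtain ⟨ψ, hψ, hφψ⟩ := TraceLipschitz.exists_near hφ hc hε
  obtain ⟨b, hb, hψb⟩ := hψ.bounded
  have hφb : ∀ x, ‖φ x‖ ≤ ε + b := fun x => by
    simpa using (norm_add_le (φ x - ψ x) (ψ x)).trans (add_le_add (hφψ x) (hψb x))
  exact ⟨_, _, tendsto_eigenvalueMean_of_traceLipschitz hf hherm hψ,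
    fun n => norm_eigenvalueMean_sub_le _ hε.le fun j => hφψ _,
    norm_symbolMean_sub_le (intervalIntegrable_symmetricMean hf hφ (by positivity) hφb)
      (intervalIntegrable_symmetricMean hf hψ.continuous hb hψb)
      fun θ _ => norm_symmetricMean_sub_le hε.le fun _ x _ => hφψ x⟩

end Limit

/-- For a matrix-valued symbol `f : [-π,π] → ℂ^{s×s}` with integrable
entries and Hermitian Fourier coefficients `A k`, the matrices `(Yₙ ⊗ Iₛ) Tₙₛ[f]` are
Hermitian and their eigenvalues are distributed as `ψ_{|f|}` with `|f| = (ffᴴ)^{1/2}`. -/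
theorem flipped_block_toeplitz_eigenvalue_distribution
    (s : ℕ) (hs : 1 ≤ s)
    (f : ℝ → Matrix (Fin s) (Fin s) ℂ)
    (hfint : ∀ p q : Fin s, IntegrableOn (fun θ => f θ p q) (Set.Icc (-Real.pi) Real.pi))
    (A : ℤ → Matrix (Fin s) (Fin s) ℂ)
    (hA : ∀ k : ℤ, ∀ p q : Fin s, A k p q =
      (1 / (2 * Real.pi) : ℂ) *
        ∫ θ in (-Real.pi)..Real.pi, f θ p q * Complex.exp (-Complex.I * k * θ))
    (hAherm : ∀ k : ℤ, (A k).IsHermitian)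
    (T : (n : ℕ) → Matrix (Fin n × Fin s) (Fin n × Fin s) ℂ)
    (hT : ∀ n, ∀ jp kq : Fin n × Fin s, T n jp kq = A ((jp.1 : ℤ) - (kq.1 : ℤ)) jp.2 kq.2)
    (YI : (n : ℕ) → Matrix (Fin n × Fin s) (Fin n × Fin s) ℂ)
    (hYI : ∀ n, ∀ jp kq : Fin n × Fin s,
      YI n jp kq = if (jp.1 : ℕ) + (kq.1 : ℕ) + 1 = n ∧ jp.2 = kq.2 then 1 else 0) :
    ∃ hsym : ∀ n, (YI n * T n).IsHermitian,
      ∀ F : ℂ → ℂ, Continuous F → HasCompactSupport F →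
        Tendsto (fun n : ℕ =>
            ((s * n : ℕ) : ℂ)⁻¹ * ∑ j, F (((hsym n).eigenvalues j : ℂ))) atTop
          (nhds ((1 / (4 * Real.pi) : ℂ) *
            ∫ θ in (-Real.pi)..Real.pi, (s : ℂ)⁻¹ *
              ∑ j : Fin s,
                (F ((absEigenvalues (f θ) j : ℝ) : ℂ) +
                  F ((-(absEigenvalues (f θ) j) : ℝ) : ℂ)))) := by
  obtain rfl : A = blockFourierCoeff f := by
    ext k p q
    rw [hA, blockFourierCoeff, of_apply]
  have hf : ∀ p q, IntervalIntegrable (fun θ => f θ p q) volume (-Real.pi) Real.pi := fun p q =>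
    (intervalIntegrable_iff_integrableOn_Ioc_of_le (by linarith [Real.pi_pos])).2
      ((hfint p q).mono_set Set.Ioc_subset_Icc_self)
  have hprod := fun n => flip_mul_toeplitz (hT n) (hYI n)
  have heig : ∀ {n : ℕ} {H K : Matrix (Fin n × Fin s) (Fin n × Fin s) ℂ} (_ : H = K)
      (hH : H.IsHermitian) (hK : K.IsHermitian), hH.eigenvalues = hK.eigenvalues := by
    rintro n H _ rfl hH hK
    rfl
  refine ⟨fun n => by rw [hprod n]; exact flippedToeplitz_isHermitian n hAherm,
    fun F hF hc => ?_⟩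
  refine Tendsto.congr (fun n => ?_) (tendsto_eigenvalueMean hf hAherm
    (φ := fun x : ℝ => F (x : ℂ)) (hF.comp Complex.continuous_ofReal)
    (hc.comp_isClosedEmbedding Complex.isometry_ofReal.isClosedEmbedding))
  rw [heig (hprod n) _ (flippedToeplitz_isHermitian n hAherm), eigenvalueMean]
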